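/- arXiv:0904.0687 — 12 statements merged into one kernel-verified Lean document; each statement's English description precedes it below -/
import Mathlib

section
/- Suppose in addition that d : F → ℝ satisfies d(u) ≥ 0 for all u ∈ U, that σ > 0 and L > 0 are constants, and set D := max_{u∈U} d(u). Let (u_i)_{i≥0} and (u_k^{sd})_{k≥0} be sequences in U such that for every k ≥ 0, ((k+1)(k+2)/4)·f(u_k^{sd}) ≤ min_{u∈U} [ (L/σ)·d(u) + Σ_{i=0}^{k} ((i+1)/2)·( f(u_i) + ⟨∇_u φ(x(u_i),u_i), u − u_i⟩ ) ], where ∇_u φ denotes the gradient of φ in its second argument. For k ≥ 0 define x_k := Σ_{i=0}^{k} (2(i+1)/((k+1)(k+2)))·x(u_i). Then for every k ≥ 0 one has 0 ≤ f(u_k^{sd}) − g(x_k) ≤ 4LD/(σ(k+1)(k+2)). -/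
open scoped RealInnerProductSpace

/-- First-order inequality: a function convex on `U` lies above its linearization at any point
of `U`. -/
theorem ConvexOn.add_inner_gradient_le {F : Type*} [NormedAddCommGroup F]
    [InnerProductSpace ℝ F] [CompleteSpace F] {U : Set F} {h : F → ℝ} (hh : ConvexOn ℝ U h)
    {u v G : F} (hu : u ∈ U) (hv : v ∈ U) (hG : HasGradientAt h G u) :
    h u + ⟪G, v - u⟫ ≤ h v := by
  let l : ℝ →ᵃ[ℝ] F := AffineMap.lineMap u v
  have hl0 : l 0 = u := AffineMap.lineMap_apply_zero u v
  have hl1 : l 1 = v := AffineMap.lineMap_apply_one u v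
  have hd : HasDerivAt (h ∘ l) ⟪G, v - u⟫ 0 := by
    have hG' := hG.hasFDerivAt
    rw [← hl0] at hG'
    have := hG'.comp_hasDerivAt (0 : ℝ) (AffineMap.hasDerivAt_lineMap (a := u) (b := v))
    simpa using this
  have := (hh.comp_affineMap l).le_slope_of_hasDerivAt (x := 0) (y := 1)
    (by simpa [hl0] using hu) (by simpa [hl1] using hv) zero_lt_one hd
  simp only [slope_def_field, Function.comp_apply, hl0, hl1, sub_zero, div_one] at this
  linarith

theorem sum_range_add_one_div_two (k : ℕ) :
    ∑ i ∈ Finset.range (k + 1), ((i : ℝ) + 1) / 2 = ((k : ℝ) + 1) * ((k : ℝ) + 2) / 4 := by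
  induction k with
  | zero => norm_num
  | succ k ih =>
    rw [Finset.sum_range_succ, ih]
    push_cast
    ring

/-- Theorem 2.2 (convergence of the Smooth Minimization Algorithm). -/
theorem smooth_minimization_convergence
    {E F : Type*} [NormedAddCommGroup E] [InnerProductSpace ℝ E] [FiniteDimensional ℝ E]
    [NormedAddCommGroup F] [InnerProductSpace ℝ F] [FiniteDimensional ℝ F]
    (X : Set E) (U : Set F) (φ : E → F → ℝ)
    (hXne : X.Nonempty) (hXconv : Convex ℝ X) (hXcomp : IsCompact X)
    (hUne : U.Nonempty) (hUconv : Convex ℝ U) (hUcomp : IsCompact U)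
    (hcont : ContinuousOn (fun p : E × F => φ p.1 p.2) (X ×ˢ U))
    (hconc : ∀ u ∈ U, StrictConcaveOn ℝ X (fun x => φ x u))
    (hconv : ∀ x ∈ X, ConvexOn ℝ U (fun u => φ x u))
    (G : E → F → F)
    (hG : ∀ x ∈ X, ∀ u ∈ U, HasGradientAt (fun v => φ x v) (G x u) u)
    (g : E → ℝ) (hg : ∀ x, g x = sInf ((fun u => φ x u) '' U))
    (f : F → ℝ) (hf : ∀ u, f u = sSup ((fun x => φ x u) '' X))
    (xopt : F → E)
    (hxopt : ∀ u ∈ U, xopt u ∈ X ∧ IsMaxOn (fun x => φ x u) X (xopt u))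
    (d : F → ℝ) (hd : ∀ u ∈ U, 0 ≤ d u)
    (σ L D : ℝ) (hσ : 0 < σ) (hL : 0 < L)
    (hD : IsGreatest (d '' U) D)
    (u usd : ℕ → F) (hu : ∀ k, u k ∈ U) (husd : ∀ k, usd k ∈ U)
    (hineq : ∀ k : ℕ,
      ((k : ℝ) + 1) * ((k : ℝ) + 2) / 4 * f (usd k) ≤
        sInf ((fun v => L / σ * d v +
          ∑ i ∈ Finset.range (k + 1), (((i : ℝ) + 1) / 2) *
            (f (u i) + ⟪G (xopt (u i)) (u i), v - u i⟫)) '' U))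
    (x : ℕ → E)
    (hx : ∀ k : ℕ, x k = ∑ i ∈ Finset.range (k + 1),
        (2 * ((i : ℝ) + 1) / (((k : ℝ) + 1) * ((k : ℝ) + 2))) • xopt (u i)) :
    ∀ k : ℕ, 0 ≤ f (usd k) - g (x k) ∧
      f (usd k) - g (x k) ≤ 4 * L * D / (σ * ((k : ℝ) + 1) * ((k : ℝ) + 2)) := by
  intro k
  set S : ℝ := ((k : ℝ) + 1) * ((k : ℝ) + 2) / 4 with hS
  have hSpos : 0 < S := by positivity
  have hweight : ∀ i : ℕ,
      2 * ((i : ℝ) + 1) / (((k : ℝ) + 1) * ((k : ℝ) + 2)) = ((i : ℝ) + 1) / 2 / S := by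
    intro i
    rw [hS]
    field_simp
    ring
  have hxk : x k = ∑ i ∈ Finset.range (k + 1), (((i : ℝ) + 1) / 2 / S) • xopt (u i) := by
    simp only [hx, hweight]
  have hnonneg : ∀ i ∈ Finset.range (k + 1), 0 ≤ ((i : ℝ) + 1) / 2 / S := fun i _ => by
    positivity
  have hsum : ∑ i ∈ Finset.range (k + 1), ((i : ℝ) + 1) / 2 / S = 1 := by
    rw [← Finset.sum_div, sum_range_add_one_div_two, div_self hSpos.ne']
  have hmem : ∀ i ∈ Finset.range (k + 1), xopt (u i) ∈ X := fun i _ => (hxopt _ (hu i)).1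
  have hxX : x k ∈ X := hxk ▸ hXconv.sum_mem hnonneg hsum hmem
  have hcontU : ContinuousOn (fun v => φ (x k) v) U :=
    hcont.comp (f := fun v => (x k, v)) (by fun_prop) fun v hv => ⟨hxX, hv⟩
  have hcontX : ContinuousOn (fun y => φ y (usd k)) X :=
    hcont.comp (f := fun y => (y, usd k)) (by fun_prop) fun y hy => ⟨hy, husd k⟩
  have hfu : ∀ i, f (u i) = φ (xopt (u i)) (u i) := fun i => by
    rw [hf]
    exact IsGreatest.csSup_eq ⟨⟨_, (hxopt _ (hu i)).1, rfl⟩,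
      Set.forall_mem_image.2 fun y hy => (hxopt _ (hu i)).2 hy⟩
  have hjensen : ∀ v ∈ U,
      ∑ i ∈ Finset.range (k + 1), ((i : ℝ) + 1) / 2 * φ (xopt (u i)) v ≤ S * φ (x k) v := by
    intro v hv
    have := (hconc v hv).concaveOn.le_map_sum hnonneg hsum hmem
    rw [← hxk] at this
    calc _ = S * ∑ i ∈ Finset.range (k + 1), (((i : ℝ) + 1) / 2 / S) • φ (xopt (u i)) v := by
          rw [Finset.mul_sum]
          refine Finset.sum_congr rfl fun i _ => ?_
          rw [smul_eq_mul]
          field_simp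
      _ ≤ _ := by gcongr
  have hbdd : BddBelow ((fun v => L / σ * d v +
      ∑ i ∈ Finset.range (k + 1), (((i : ℝ) + 1) / 2) *
        (f (u i) + ⟪G (xopt (u i)) (u i), v - u i⟫)) '' U) := by
    obtain ⟨m, hm⟩ := hUcomp.bddBelow_image (f := fun v =>
      ∑ i ∈ Finset.range (k + 1), (((i : ℝ) + 1) / 2) *
        (f (u i) + ⟪G (xopt (u i)) (u i), v - u i⟫)) (by fun_prop)
    refine ⟨m, Set.forall_mem_image.2 fun v hv => ?_⟩
    have h1 := hm (Set.mem_image_of_mem _ hv)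
    have h2 : 0 ≤ L / σ * d v := mul_nonneg (by positivity) (hd v hv)
    exact h1.trans (le_add_of_nonneg_left h2)
  have hbound : ∀ v ∈ U, S * f (usd k) ≤ L / σ * D + S * φ (x k) v := by
    intro v hv
    refine (hineq k).trans ((csInf_le hbdd (Set.mem_image_of_mem _ hv)).trans ?_)
    refine add_le_add ?_ (le_trans (Finset.sum_le_sum fun i hi => ?_) (hjensen v hv))
    · have := hD.2 (Set.mem_image_of_mem _ hv)
      gcongr
    · rw [hfu]
      gcongr
      exact (hconv _ (hmem i hi)).add_inner_gradient_le (hu i) hv (hG _ (hmem i hi) _ (hu i))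
  constructor
  · rw [hg, hf, sub_nonneg]
    exact (csInf_le (hUcomp.bddBelow_image hcontU) (Set.mem_image_of_mem _ (husd k))).trans
      (le_csSup (hXcomp.bddAbove_image hcontX) (Set.mem_image_of_mem _ hxX))
  · have hlower : f (usd k) - L / σ * D / S ≤ g (x k) := by
      rw [hg]
      refine le_csInf (hUne.image _) (Set.forall_mem_image.2 fun v hv => ?_)
      rw [sub_le_iff_le_add, ← mul_le_mul_iff_right₀ hSpos, mul_add, mul_div_cancel₀ _ hSpos.ne']
      linarith [hbound v hv]
    have heq : 4 * L * D / (σ * ((k : ℝ) + 1) * ((k : ℝ) + 2)) = L / σ * D / S := by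
      rw [hS]
      field_simp
    linarith
end

section
/- Let (u_i)_{i≥0} be any sequence in U, and for k ≥ 0 define x_k := Σ_{i=0}^{k} (2(i+1)/((k+1)(k+2)))·x(u_i). Then x_k ∈ X and for every u ∈ U and every k ≥ 0, Σ_{i=0}^{k} (i+1)·( φ(x(u_i),u_i) + ⟨∇_u φ(x(u_i),u_i), u − u_i⟩ ) ≤ ((k+1)(k+2)/2)·φ(x_k, u), where ∇_u φ denotes the gradient of φ in its second argument. -/
open scoped RealInnerProductSpace

/-- The first-order condition for convexity: a convex function lies above its tangent planes. -/
theorem ConvexOn.add_inner_le_of_hasGradientAt {F : Type*} [NormedAddCommGroup F]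
    [InnerProductSpace ℝ F] [CompleteSpace F] {s : Set F} {f : F → ℝ} {g a b : F}
    (hf : ConvexOn ℝ s f) (ha : a ∈ s) (hb : b ∈ s) (hg : HasGradientAt f g a) :
    f a + ⟪g, b - a⟫ ≤ f b := by
  have hconv := hf.comp_affineMap (AffineMap.lineMap a b : ℝ →ᵃ[ℝ] F)
  have hderiv : HasDerivAt (f ∘ (AffineMap.lineMap a b : ℝ →ᵃ[ℝ] F)) ⟪g, b - a⟫ 0 := by
    have hfa : HasFDerivAt f (InnerProductSpace.toDual ℝ F g)
        ((AffineMap.lineMap a b : ℝ →ᵃ[ℝ] F) 0) := by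
      simpa using hg.hasFDerivAt
    simpa using hfa.comp_hasDerivAt (0 : ℝ) AffineMap.hasDerivAt_lineMap
  have h := hconv.le_slope_of_hasDerivAt (x := 0) (y := 1) (by simpa using ha)
    (by simpa using hb) zero_lt_one hderiv
  simp only [slope_def_field, Function.comp_apply, AffineMap.lineMap_apply_one,
    AffineMap.lineMap_apply_zero, sub_zero, div_one] at h
  linarith

theorem sum_range_succ_natCast_add_one (k : ℕ) :
    ∑ i ∈ Finset.range (k + 1), ((i : ℝ) + 1) = ((k : ℝ) + 1) * ((k : ℝ) + 2) / 2 := by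
  induction k with
  | zero => norm_num
  | succ k ih =>
    rw [Finset.sum_range_succ, ih]
    push_cast
    ring

/-- Key estimate in the proof of Theorem 2.2: convex-combination iterates satisfy the
linearization bound. -/
theorem weighted_linearization_bound
    {E F : Type*} [NormedAddCommGroup E] [InnerProductSpace ℝ E] [FiniteDimensional ℝ E]
    [NormedAddCommGroup F] [InnerProductSpace ℝ F] [FiniteDimensional ℝ F]
    (X : Set E) (U : Set F) (φ : E → F → ℝ)
    (hXne : X.Nonempty) (hXconv : Convex ℝ X) (hXcomp : IsCompact X)
    (hUne : U.Nonempty) (hUconv : Convex ℝ U) (hUcomp : IsCompact U)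
    (hcont : ContinuousOn (fun p : E × F => φ p.1 p.2) (X ×ˢ U))
    (hconc : ∀ u ∈ U, StrictConcaveOn ℝ X (fun x => φ x u))
    (hconv : ∀ x ∈ X, ConvexOn ℝ U (fun u => φ x u))
    (G : E → F → F)
    (hG : ∀ x ∈ X, ∀ u ∈ U, HasGradientAt (fun v => φ x v) (G x u) u)
    (xopt : F → E)
    (hxopt : ∀ u ∈ U, xopt u ∈ X ∧ IsMaxOn (fun x => φ x u) X (xopt u))
    (u : ℕ → F) (hu : ∀ k, u k ∈ U)
    (x : ℕ → E)
    (hx : ∀ k : ℕ, x k = ∑ i ∈ Finset.range (k + 1),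
        (2 * ((i : ℝ) + 1) / (((k : ℝ) + 1) * ((k : ℝ) + 2))) • xopt (u i)) :
    ∀ k : ℕ, x k ∈ X ∧ ∀ v ∈ U,
      ∑ i ∈ Finset.range (k + 1), ((i : ℝ) + 1) *
          (φ (xopt (u i)) (u i) + ⟪G (xopt (u i)) (u i), v - u i⟫) ≤
        ((k : ℝ) + 1) * ((k : ℝ) + 2) / 2 * φ (x k) v := by
  intro k
  set c : ℝ := ((k : ℝ) + 1) * ((k : ℝ) + 2) / 2 with hc
  have hcpos : 0 < c := by positivity
  have hw : ∀ i : ℕ, 2 * ((i : ℝ) + 1) / (((k : ℝ) + 1) * ((k : ℝ) + 2)) = ((i : ℝ) + 1) / c := by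
    intro i
    rw [hc]
    field_simp
  have hxk : x k = ∑ i ∈ Finset.range (k + 1), (((i : ℝ) + 1) / c) • xopt (u i) := by
    simp only [hx k, hw]
  have hnonneg : ∀ i ∈ Finset.range (k + 1), 0 ≤ ((i : ℝ) + 1) / c := fun i _ => by positivity
  have hsum : ∑ i ∈ Finset.range (k + 1), ((i : ℝ) + 1) / c = 1 := by
    rw [← Finset.sum_div, sum_range_succ_natCast_add_one, div_self hcpos.ne']
  have hmem : ∀ i, xopt (u i) ∈ X := fun i => (hxopt _ (hu i)).1
  rw [hxk]
  refine ⟨hXconv.sum_mem hnonneg hsum fun i _ => hmem i, fun v hv => ?_⟩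
  calc
    _ ≤ ∑ i ∈ Finset.range (k + 1), ((i : ℝ) + 1) * φ (xopt (u i)) v := by
      gcongr with i
      exact (hconv _ (hmem i)).add_inner_le_of_hasGradientAt (hu i) hv (hG _ (hmem i) _ (hu i))
    _ = c * ∑ i ∈ Finset.range (k + 1), (((i : ℝ) + 1) / c) • φ (xopt (u i)) v := by
      rw [Finset.mul_sum]
      refine Finset.sum_congr rfl fun i _ => ?_
      rw [smul_eq_mul, ← mul_assoc, mul_div_cancel₀ _ hcpos.ne']
    _ ≤ _ := by
      gcongr
      exact (hconc v hv).concaveOn.le_map_sum hnonneg hsum fun i _ => hmem i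
end

section
/- Assume that min_{u∈U} f(u) = max_{x∈X} g(x). Then the problem max_{x∈X} g(x) has a unique optimal solution x*, and for every u* ∈ U minimizing f over U, x* is the unique maximizer of φ(·,u*) over X; moreover (x*,u*) is a saddle point, i.e. φ(x*,u) ≥ φ(x*,u*) ≥ φ(x,u*) for all x ∈ X and u ∈ U. -/
/-- Over a compact parameter set, the partial infimum of a jointly continuous function is
continuous. -/
theorem continuousOn_sInf_image_of_isCompact {α β : Type*} [TopologicalSpace α]
    [TopologicalSpace β] {X : Set α} {U : Set β} {φ : α → β → ℝ} (hU : IsCompact U)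
    (hφ : ContinuousOn (fun p : α × β => φ p.1 p.2) (X ×ˢ U)) :
    ContinuousOn (fun x => sInf ((fun u => φ x u) '' U)) X := by
  have : CompactSpace U := isCompact_iff_compactSpace.mp hU
  have hcont : Continuous (fun p : X × U => φ p.1 p.2) :=
    hφ.comp_continuous (f := fun p : X × U => ((p.1 : α), (p.2 : β))) (by fun_prop)
      fun p => ⟨p.1.2, p.2.2⟩
  rw [continuousOn_iff_continuous_domRestrict]
  convert (isCompact_univ (X := U)).continuous_sInf
    (f := fun (x : X) (u : U) => φ x u) hcont using 2 with x
  rw [Set.domRestrict_apply, Set.image_univ, Set.image_eq_range]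

/-- Lemma 2.4: uniqueness of the optimal solution of the non-smooth concave maximization
problem, and the saddle-point property with any dual minimizer. -/
theorem unique_primal_solution_and_saddle
    {E F : Type*} [NormedAddCommGroup E] [InnerProductSpace ℝ E] [FiniteDimensional ℝ E]
    [NormedAddCommGroup F] [InnerProductSpace ℝ F] [FiniteDimensional ℝ F]
    (X : Set E) (U : Set F) (φ : E → F → ℝ)
    (hXne : X.Nonempty) (hXconv : Convex ℝ X) (hXcomp : IsCompact X)
    (hUne : U.Nonempty) (hUconv : Convex ℝ U) (hUcomp : IsCompact U)
    (hcont : ContinuousOn (fun p : E × F => φ p.1 p.2) (X ×ˢ U))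
    (hconc : ∀ u ∈ U, StrictConcaveOn ℝ X (fun x => φ x u))
    (hconv : ∀ x ∈ X, ConvexOn ℝ U (fun u => φ x u))
    (g : E → ℝ) (hg : ∀ x, g x = sInf ((fun u => φ x u) '' U))
    (f : F → ℝ) (hf : ∀ u, f u = sSup ((fun x => φ x u) '' X))
    (hdual : sInf (f '' U) = sSup (g '' X)) :
    ∃ xstar ∈ X, IsMaxOn g X xstar ∧
      (∀ x' ∈ X, IsMaxOn g X x' → x' = xstar) ∧
      ∀ ustar ∈ U, IsMinOn f U ustar →
        (IsMaxOn (fun x => φ x ustar) X xstar ∧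
          (∀ x' ∈ X, IsMaxOn (fun x => φ x ustar) X x' → x' = xstar) ∧
          ∀ x' ∈ X, ∀ u' ∈ U,
            φ x' ustar ≤ φ xstar ustar ∧ φ xstar ustar ≤ φ xstar u') := by
  have hcont_right (x) (hx : x ∈ X) : ContinuousOn (fun u => φ x u) U :=
    hcont.comp (f := fun u => (x, u)) (by fun_prop) fun u hu => ⟨hx, hu⟩
  have hcont_left (u) (hu : u ∈ U) : ContinuousOn (fun x => φ x u) X :=
    hcont.comp (f := fun x => (x, u)) (by fun_prop) fun x hx => ⟨hx, hu⟩
  have hg_le (x) (hx : x ∈ X) (u) (hu : u ∈ U) : g x ≤ φ x u := by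
    rw [hg]
    exact csInf_le (hUcomp.image_of_continuousOn (hcont_right x hx)).bddBelow ⟨u, hu, rfl⟩
  have hle_f (x) (hx : x ∈ X) (u) (hu : u ∈ U) : φ x u ≤ f u := by
    rw [hf]
    exact le_csSup (hXcomp.image_of_continuousOn (hcont_left u hu)).bddAbove ⟨x, hx, rfl⟩
  have hg_cont : ContinuousOn g X := by
    rw [funext hg]
    exact continuousOn_sInf_image_of_isCompact hUcomp hcont
  obtain ⟨xstar, hxstar, hmax⟩ := hXcomp.exists_isMaxOn hXne hg_cont
  have hg_conc : StrictConcaveOn ℝ X g := by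
    refine ⟨hXconv, fun x hx y hy hxy a b ha hb hab => ?_⟩
    have hz := hXconv hx hy ha.le hb.le hab
    obtain ⟨u, hu, hgu⟩ := hUcomp.exists_sInf_image_eq hUne (hcont_right _ hz)
    rw [hg (a • x + b • y), hgu]
    refine lt_of_le_of_lt ?_ ((hconc u hu).2 hx hy hxy ha hb hab)
    simp only [smul_eq_mul]
    gcongr
    · exact hg_le x hx u hu
    · exact hg_le y hy u hu
  refine ⟨xstar, hxstar, hmax,
    fun x' hx' hmax' => hg_conc.eq_of_isMaxOn hmax' hmax hx' hxstar,
    fun ustar hustar hmin => ?_⟩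
  have hgmax : IsGreatest (g '' X) (g xstar) :=
    ⟨⟨xstar, hxstar, rfl⟩, by rintro _ ⟨x, hx, rfl⟩; exact hmax hx⟩
  have hfmin : IsLeast (f '' U) (f ustar) :=
    ⟨⟨ustar, hustar, rfl⟩, by rintro _ ⟨u, hu, rfl⟩; exact hmin hu⟩
  have hval : f ustar = g xstar := by rw [← hfmin.csInf_eq, hdual, hgmax.csSup_eq]
  have hsaddle (x) (hx : x ∈ X) (u) (hu : u ∈ U) :
      φ x ustar ≤ φ xstar ustar ∧ φ xstar ustar ≤ φ xstar u := by
    have := hle_f x hx ustar hustar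
    have := hg_le xstar hxstar ustar hustar
    have := hle_f xstar hxstar ustar hustar
    have := hg_le xstar hxstar u hu
    constructor <;> linarith
  have hmax_left : IsMaxOn (fun x => φ x ustar) X xstar :=
    fun x hx => (hsaddle x hx ustar hustar).1
  exact ⟨hmax_left,
    fun x' hx' hmax' => (hconc ustar hustar).eq_of_isMaxOn hmax' hmax_left hx' hxstar,
    hsaddle⟩
end

section
/- Suppose X* is a positive definite matrix maximizing F over the set of symmetric positive definite n×n matrices. Then ⟨X*, Σ⟩ + ρ·eᵀ|X*|e = n. -/
open Matrix

/-- If `a log t - t b` is maximal over `t > 0` at `t = 1`, then `a = b`. -/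
theorem eq_of_forall_mul_log_sub_mul_le {a b : ℝ}
    (h : ∀ t : ℝ, 0 < t → a * Real.log t - t * b ≤ -b) : a = b := by
  have hderiv : HasDerivAt (fun t : ℝ => a * Real.log t - t * b) (a * 1⁻¹ - 1 * b) 1 :=
    ((Real.hasDerivAt_log one_ne_zero).const_mul a).sub ((hasDerivAt_id 1).mul_const b)
  have hmax : IsLocalMax (fun t : ℝ => a * Real.log t - t * b) 1 := by
    filter_upwards [lt_mem_nhds one_pos] with t ht
    simpa using h t ht
  have := hmax.hasDerivAt_eq_zero hderiv
  linarith

/-- First-order optimality identity: at the optimum of the `l₁`-penalized maximum likelihood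
problem, `⟨X*, Σ⟩ + ρ eᵀ|X*|e = n`. -/
theorem trace_identity_at_optimum
    (n : ℕ) (hn : 0 < n)
    (Sig : Matrix (Fin n) (Fin n) ℝ) (hSig : Sig.PosSemidef) (ρ : ℝ) (hρ : 0 < ρ)
    (Xstar : Matrix (Fin n) (Fin n) ℝ) (hXstar : Xstar.PosDef)
    (hopt : ∀ Y : Matrix (Fin n) (Fin n) ℝ, Y.PosDef →
      Real.log Y.det - (Sig * Yᵀ).trace - ρ * ∑ i, ∑ j, |Y i j| ≤
        Real.log Xstar.det - (Sig * Xstarᵀ).trace - ρ * ∑ i, ∑ j, |Xstar i j|) :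
    (Xstar * Sigᵀ).trace + ρ * ∑ i, ∑ j, |Xstar i j| = n := by
  have htr : (Xstar * Sigᵀ).trace = (Sig * Xstarᵀ).trace := by
    rw [← trace_transpose, transpose_mul, transpose_transpose]
  rw [htr]
  refine (eq_of_forall_mul_log_sub_mul_le fun t ht => ?_).symm
  have hY := hopt (t • Xstar) (hXstar.smul ht)
  have hlog : Real.log (t • Xstar).det = n * Real.log t + Real.log Xstar.det := by
    rw [det_smul, Fintype.card_fin, Real.log_mul (pow_pos ht n).ne' hXstar.det_pos.ne',
      Real.log_pow]
  have hsum : ∑ i, ∑ j, |(t • Xstar) i j| = t * ∑ i, ∑ j, |Xstar i j| := by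
    simp [abs_mul, abs_of_pos ht, Finset.mul_sum]
  rw [hlog, hsum, transpose_smul, Matrix.mul_smul, trace_smul, smul_eq_mul] at hY
  linarith
end

section
/- Suppose X* is a positive definite matrix maximizing F over the set of symmetric positive definite n×n matrices. Then there exists a symmetric n×n matrix U* with |U*_{ij}| ≤ 1 for all i,j such that X*·(Σ + ρ·U*) = I and ⟨X*, U*⟩ = eᵀ|X*|e; in particular X* = (Σ + ρ·U*)⁻¹. -/
open Matrix

section

open Topology Filter

variable {n : Type*} [Fintype n]

/-- Positive definiteness is an open condition among Hermitian matrices. -/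
theorem Matrix.PosDef.eventually_posDef {X : Matrix n n ℝ} (hX : X.PosDef) :
    ∀ᶠ M in 𝓝 X, M.IsHermitian → M.PosDef := by
  have hsphere : ∀ᶠ M in 𝓝 X, ∀ x ∈ Metric.sphere (0 : n → ℝ) 1, 0 < x ⬝ᵥ (M *ᵥ x) := by
    refine (isCompact_sphere (0 : n → ℝ) 1).eventually_forall_of_forall_eventually fun x hx ↦ ?_
    have hcont : Continuous fun z : Matrix n n ℝ × (n → ℝ) ↦ z.2 ⬝ᵥ (z.1 *ᵥ z.2) := by fun_prop
    have hx0 : x ≠ 0 := ne_zero_of_mem_unit_sphere (⟨x, hx⟩ : Metric.sphere (0 : n → ℝ) 1)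
    exact hcont.continuousAt.eventually (lt_mem_nhds (by simpa using hX.dotProduct_mulVec_pos hx0))
  filter_upwards [hsphere] with M hM hMh
  refine .of_dotProduct_mulVec_pos hMh fun x hx ↦ ?_
  have hpos : 0 < ‖x‖ := norm_pos_iff.2 hx
  have h := hM (‖x‖⁻¹ • x) (by simp [norm_smul, hpos.ne'])
  rw [mulVec_smul, dotProduct_smul, smul_dotProduct, smul_eq_mul, smul_eq_mul] at h
  have hinv : 0 < ‖x‖⁻¹ := inv_pos.2 hpos
  rw [star_trivial]
  exact pos_of_mul_pos_right (pos_of_mul_pos_right h hinv.le) hinv.le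

theorem Matrix.sum_abs_add_smul_le (X H : Matrix n n ℝ) {t : ℝ} (ht : 0 ≤ t) :
    ∑ i, ∑ j, |(X + t • H) i j| ≤ ∑ i, ∑ j, |X i j| + t * ∑ i, ∑ j, |H i j| := by
  simp_rw [Finset.mul_sum, ← Finset.sum_add_distrib]
  gcongr with i _ j _
  simpa [abs_mul, abs_of_nonneg ht] using abs_add_le (X i j) (t * H i j)

variable [DecidableEq n]

theorem Matrix.hasDerivAt_det_one_add_smul (M : Matrix n n ℝ) :
    HasDerivAt (fun t : ℝ ↦ (1 + t • M).det) M.trace 0 := by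
  rw [funext fun t : ℝ ↦ det_one_add_smul t M]
  set p := (det (1 + (Polynomial.X : Polynomial ℝ) • M.map Polynomial.C)).divX.divX
  have h := (((hasDerivAt_id (0 : ℝ)).const_mul M.trace).const_add 1).add
    ((p.hasDerivAt 0).mul ((hasDerivAt_id (0 : ℝ)).pow 2))
  exact h.congr_deriv (by simp)

theorem Matrix.PosDef.hasDerivAt_log_det_add_smul {X : Matrix n n ℝ} (hX : X.PosDef)
    (H : Matrix n n ℝ) :
    HasDerivAt (fun t : ℝ ↦ Real.log (X + t • H).det) (X⁻¹ * H).trace 0 := by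
  have hdet := hX.det_pos
  have hfactor (t : ℝ) : (X + t • H).det = X.det * (1 + t • (X⁻¹ * H)).det := by
    rw [← det_mul, mul_add, mul_one, Matrix.mul_smul,
      mul_nonsing_inv_cancel_left _ _ hdet.ne'.isUnit]
  simp_rw [hfactor]
  have h := ((hasDerivAt_det_one_add_smul (X⁻¹ * H)).const_mul X.det).log (by simpa using hdet.ne')
  simpa [hdet.ne'] using h

/-- First-order optimality for the penalized log-likelihood along a symmetric direction `H` in which
the `ℓ₁` norm grows at rate at most `c`. -/
theorem Matrix.PosDef.trace_sub_mul_le_of_forall_le {S X H : Matrix n n ℝ} (hX : X.PosDef)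
    {ρ c : ℝ} (hρ : 0 ≤ ρ)
    (hopt : ∀ Y : Matrix n n ℝ, Y.PosDef →
      Real.log Y.det - (S * Yᵀ).trace - ρ * ∑ i, ∑ j, |Y i j| ≤
        Real.log X.det - (S * Xᵀ).trace - ρ * ∑ i, ∑ j, |X i j|)
    (hH : H.IsSymm)
    (hc : ∀ t : ℝ, 0 ≤ t → t ≤ 1 → ∑ i, ∑ j, |(X + t • H) i j| ≤ ∑ i, ∑ j, |X i j| + t * c) :
    ((X⁻¹ - S) * H).trace ≤ ρ * c := by
  have hderiv := (hX.hasDerivAt_log_det_add_smul H).hasDerivWithinAt (s := Set.Ioi 0)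
  rw [hasDerivWithinAt_iff_tendsto_slope' (by simp)] at hderiv
  have hXt : Xᵀ = X := by
    rw [← conjTranspose_eq_transpose_of_trivial, hX.isHermitian.eq]
  have hposDef : ∀ᶠ t : ℝ in 𝓝[>] 0, (X + t • H).PosDef := by
    have hcont : Continuous fun t : ℝ ↦ X + t • H := by fun_prop
    have hlim : Tendsto (fun t : ℝ ↦ X + t • H) (𝓝[>] 0) (𝓝 X) := by
      simpa using (hcont.tendsto 0).mono_left nhdsWithin_le_nhds
    filter_upwards [hlim.eventually hX.eventually_posDef] with t ht
    refine ht ?_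
    rw [IsHermitian, conjTranspose_eq_transpose_of_trivial, transpose_add, transpose_smul, hXt, hH]
  have hle : (X⁻¹ * H).trace ≤ (S * H).trace + ρ * c := by
    refine le_of_tendsto hderiv ?_
    filter_upwards [hposDef, self_mem_nhdsWithin, Ioc_mem_nhdsGT (zero_lt_one (α := ℝ))]
      with t ht (ht0 : 0 < t) ht1
    have h := hopt _ ht
    have hpen := mul_le_mul_of_nonneg_left (hc t ht0.le ht1.2) hρ
    rw [transpose_add, transpose_smul, hH, mul_add, Matrix.mul_smul, trace_add, trace_smul,
      smul_eq_mul] at h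
    rw [slope_def_field, zero_smul, add_zero, sub_zero, div_le_iff₀ ht0]
    linarith
  rw [sub_mul, trace_sub]
  linarith

theorem Matrix.sum_abs_single (i j : n) (a : ℝ) : ∑ k, ∑ l, |single i j a k l| = |a| := by
  rw [Fintype.sum_eq_single i, Fintype.sum_eq_single j] <;> simp +contextual [eq_comm]

end

/-- Existence of a dual certificate `U*` at the optimum: `X* (Σ + ρ U*) = I` and
`⟨X*, U*⟩ = eᵀ|X*|e`; in particular `X* = (Σ + ρ U*)⁻¹`. -/
theorem dual_certificate_at_optimum
    (n : ℕ) (hn : 0 < n)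
    (Sig : Matrix (Fin n) (Fin n) ℝ) (hSig : Sig.PosSemidef) (ρ : ℝ) (hρ : 0 < ρ)
    (Xstar : Matrix (Fin n) (Fin n) ℝ) (hXstar : Xstar.PosDef)
    (hopt : ∀ Y : Matrix (Fin n) (Fin n) ℝ, Y.PosDef →
      Real.log Y.det - (Sig * Yᵀ).trace - ρ * ∑ i, ∑ j, |Y i j| ≤
        Real.log Xstar.det - (Sig * Xstarᵀ).trace - ρ * ∑ i, ∑ j, |Xstar i j|) :
    ∃ Ustar : Matrix (Fin n) (Fin n) ℝ, Ustar.IsSymm ∧ (∀ i j, |Ustar i j| ≤ 1) ∧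
      Xstar * (Sig + ρ • Ustar) = 1 ∧
      (Xstar * Ustarᵀ).trace = ∑ i, ∑ j, |Xstar i j| ∧
      Xstar = (Sig + ρ • Ustar)⁻¹ := by
  have hdet : IsUnit Xstar.det := hXstar.det_pos.ne'.isUnit
  have hXt : Xstarᵀ = Xstar := by
    rw [← conjTranspose_eq_transpose_of_trivial, hXstar.isHermitian.eq]
  have hSt : Sigᵀ = Sig := by
    rw [← conjTranspose_eq_transpose_of_trivial, hSig.isHermitian.eq]
  set W := Xstar⁻¹ - Sig with hW
  have hWt : Wᵀ = W := by rw [hW, transpose_sub, transpose_nonsing_inv, hXt, hSt]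
  have hentry (i j : Fin n) (a : ℝ) (ha : |a| = 1) : a * W i j ≤ ρ := by
    have h := hXstar.trace_sub_mul_le_of_forall_le hρ.le hopt
      (H := single i j a + (1 : ℝ) • single j i a)
      (by simp [IsSymm, transpose_add, add_comm]) fun t ht _ ↦ sum_abs_add_smul_le _ _ ht
    have hnorm := sum_abs_add_smul_le (single i j a) (single j i a) zero_le_one
    rw [sum_abs_single, sum_abs_single, ha] at hnorm
    have hsymm : W j i = W i j := congrFun₂ hWt i j
    rw [← hW, one_smul, mul_add, trace_add, trace_mul_single, trace_mul_single, hsymm] at h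
    rw [one_smul] at hnorm
    simp only [MulOpposite.smul_eq_mul_unop, MulOpposite.unop_op] at h
    nlinarith
  have hscale (a : ℝ) (ha : |a| = 1) :
      a * (W * Xstar).trace ≤ ρ * (a * ∑ i, ∑ j, |Xstar i j|) := by
    have h := hXstar.trace_sub_mul_le_of_forall_le hρ.le hopt (H := a • Xstar)
      (c := a * ∑ i, ∑ j, |Xstar i j|) (by rw [IsSymm, transpose_smul, hXt]) fun t ht0 ht1 ↦ by
        have hnonneg : 0 ≤ 1 + t * a := by
          have := neg_abs_le a
          nlinarith
        have hfactor (i j : Fin n) : |(Xstar + t • a • Xstar) i j| = (1 + t * a) * |Xstar i j| := by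
          have hij : (Xstar + t • a • Xstar) i j = (1 + t * a) * Xstar i j := by
            simp only [Matrix.add_apply, Matrix.smul_apply, smul_eq_mul]
            ring
          rw [hij, abs_mul, abs_of_nonneg hnonneg]
        simp_rw [hfactor, ← Finset.mul_sum]
        exact le_of_eq (by ring)
    rwa [← hW, Matrix.mul_smul, trace_smul, smul_eq_mul] at h
  have hmul : Xstar * (Sig + ρ • ρ⁻¹ • W) = 1 := by
    rw [smul_inv_smul₀ hρ.ne', hW, add_sub_cancel, mul_nonsing_inv _ hdet]
  refine ⟨ρ⁻¹ • W, by rw [IsSymm, transpose_smul, hWt], fun i j ↦ ?_, hmul, ?_,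
    (inv_eq_left_inv hmul).symm⟩
  · rw [Matrix.smul_apply, smul_eq_mul, abs_mul, abs_of_pos (inv_pos.2 hρ), inv_mul_le_iff₀ hρ, mul_one,
      abs_le]
    have h1 := hentry i j 1 (by simp)
    have h2 := hentry i j (-1) (by simp)
    constructor <;> linarith
  · have h1 := hscale 1 (by simp)
    have h2 := hscale (-1) (by simp)
    rw [transpose_smul, hWt, Matrix.mul_smul, trace_smul, smul_eq_mul, trace_mul_comm,
      inv_mul_eq_iff_eq_mul₀ hρ.ne']
    linarith
end

section
/- Suppose X* is a positive definite matrix maximizing F over the set of symmetric positive definite n×n matrices. Then for every t ∈ (0,1), with X(t) := (Σ + tρI)⁻¹ (which is positive definite), one has eᵀ|X*|e − t·Tr(X*) ≤ eᵀ|X(t)|e − t·Tr(X(t)); equivalently, eᵀ|X*|e ≤ ( eᵀ|X(t)|e − t·Tr(X(t)) ) / (1 − t). -/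
open Matrix

open scoped MatrixOrder Matrix.Norms.L2Operator in
theorem Matrix.PosDef.exists_isUnit_conjTranspose_mul_self {m : Type*} [Fintype m] [DecidableEq m]
    {M : Matrix m m ℝ} (hM : M.PosDef) : ∃ B : Matrix m m ℝ, IsUnit B ∧ M = Bᴴ * B := by
  obtain ⟨B, hB, h⟩ :=
    CStarAlgebra.isStrictlyPositive_iff_eq_star_mul_self.mp hM.isStrictlyPositive
  exact ⟨B, hB, h⟩

theorem Matrix.PosDef.log_det_le_trace_sub_card {m : Type*} [Fintype m] [DecidableEq m]
    {P : Matrix m m ℝ} (hP : P.PosDef) : Real.log P.det ≤ P.trace - Fintype.card m := by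
  have hdet := hP.isHermitian.det_eq_prod_eigenvalues
  have htrace := hP.isHermitian.trace_eq_sum_eigenvalues
  simp only [RCLike.ofReal_real_eq_id, id_eq] at hdet htrace
  rw [hdet, htrace, Real.log_prod fun i _ => (hP.eigenvalues_pos i).ne']
  calc ∑ i, Real.log (hP.isHermitian.eigenvalues i)
      ≤ ∑ i, (hP.isHermitian.eigenvalues i - 1) :=
        Finset.sum_le_sum fun i _ => Real.log_le_sub_one_of_pos (hP.eigenvalues_pos i)
    _ = ∑ i, hP.isHermitian.eigenvalues i - Fintype.card m := by simp

/-- Weak duality for the log-determinant function. -/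
theorem Matrix.PosDef.log_det_add_log_det_le {m : Type*} [Fintype m] [DecidableEq m]
    {M Y : Matrix m m ℝ} (hM : M.PosDef) (hY : Y.PosDef) :
    Real.log M.det + Real.log Y.det ≤ (M * Y).trace - Fintype.card m := by
  obtain ⟨B, hB, h⟩ := hM.exists_isUnit_conjTranspose_mul_self
  have hP : (B * Y * Bᴴ).PosDef :=
    hY.mul_mul_conjTranspose_same (Matrix.vecMul_injective_iff_isUnit.mpr hB)
  have hdet : (B * Y * Bᴴ).det = M.det * Y.det := by
    rw [h]; simp only [det_mul]; ring
  have htrace : (B * Y * Bᴴ).trace = (M * Y).trace := by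
    rw [h, trace_mul_comm, Matrix.mul_assoc]
  rw [← Real.log_mul hM.det_pos.ne' hY.det_pos.ne', ← hdet, ← htrace]
  exact hP.log_det_le_trace_sub_card

theorem Matrix.trace_le_sum_abs {m : Type*} [Fintype m] (A : Matrix m m ℝ) :
    A.trace ≤ ∑ i, ∑ j, |A i j| :=
  Finset.sum_le_sum fun i _ => (le_abs_self _).trans <|
    Finset.single_le_sum (f := fun j => |A i j|) (fun _ _ => abs_nonneg _) (Finset.mem_univ i)

/-- The comparison inequality with `X(t) = (Σ + tρI)⁻¹` used to bound `eᵀ|X*|e`. -/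
theorem comparison_with_Xt
    (n : ℕ) (hn : 0 < n)
    (Sig : Matrix (Fin n) (Fin n) ℝ) (hSig : Sig.PosSemidef) (ρ : ℝ) (hρ : 0 < ρ)
    (Xstar : Matrix (Fin n) (Fin n) ℝ) (hXstar : Xstar.PosDef)
    (hopt : ∀ Y : Matrix (Fin n) (Fin n) ℝ, Y.PosDef →
      Real.log Y.det - (Sig * Yᵀ).trace - ρ * ∑ i, ∑ j, |Y i j| ≤
        Real.log Xstar.det - (Sig * Xstarᵀ).trace - ρ * ∑ i, ∑ j, |Xstar i j|) :
    ∀ t ∈ Set.Ioo (0 : ℝ) 1,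
      ((Sig + (t * ρ) • (1 : Matrix (Fin n) (Fin n) ℝ))⁻¹).PosDef ∧
      (∑ i, ∑ j, |Xstar i j|) - t * Xstar.trace ≤
        (∑ i, ∑ j, |(Sig + (t * ρ) • (1 : Matrix (Fin n) (Fin n) ℝ))⁻¹ i j|) -
          t * ((Sig + (t * ρ) • (1 : Matrix (Fin n) (Fin n) ℝ))⁻¹).trace ∧
      (∑ i, ∑ j, |Xstar i j|) ≤
        ((∑ i, ∑ j, |(Sig + (t * ρ) • (1 : Matrix (Fin n) (Fin n) ℝ))⁻¹ i j|) -
          t * ((Sig + (t * ρ) • (1 : Matrix (Fin n) (Fin n) ℝ))⁻¹).trace) / (1 - t) := by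
  rintro t ⟨ht0, ht1⟩
  set M : Matrix (Fin n) (Fin n) ℝ := Sig + (t * ρ) • 1 with hMdef
  have hM : M.PosDef := PosDef.posSemidef_add hSig (PosDef.one.smul (mul_pos ht0 hρ))
  have htrace (Y : Matrix (Fin n) (Fin n) ℝ) :
      (M * Y).trace = (Sig * Y).trace + t * ρ * Y.trace := by
    simp [hMdef, Matrix.add_mul]
  have hdual := hM.log_det_add_log_det_le hXstar
  have hle := hopt M⁻¹ hM.inv
  have hinv : (M * M⁻¹).trace = n := by
    rw [Matrix.mul_nonsing_inv _ hM.det_pos.ne'.isUnit]; simp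
  have hsymm {Y : Matrix (Fin n) (Fin n) ℝ} (hY : Y.PosDef) : Yᵀ = Y := by
    simpa using hY.isHermitian.eq
  rw [hsymm hM.inv, hsymm hXstar, det_nonsing_inv, Ring.inverse_eq_inv', Real.log_inv] at hle
  rw [htrace, Fintype.card_fin] at hdual
  rw [htrace] at hinv
  have hmain : (∑ i, ∑ j, |Xstar i j|) - t * Xstar.trace ≤
      (∑ i, ∑ j, |M⁻¹ i j|) - t * M⁻¹.trace := by
    refine le_of_mul_le_mul_left ?_ hρ
    linarith
  refine ⟨hM.inv, hmain, ?_⟩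
  rw [le_div_iff₀ (sub_pos.mpr ht1)]
  linarith [mul_le_mul_of_nonneg_left Xstar.trace_le_sum_abs ht0.le]
end

section
/- Suppose X* is a positive definite matrix maximizing F over the set of symmetric positive definite n×n matrices, and suppose Σ is invertible (positive definite). Then eᵀ|X*|e ≤ eᵀ|Σ⁻¹|e. -/
open Matrix

/-- For a positive definite real matrix, `log det M ≤ tr M - n`. -/
theorem Matrix.PosDef.log_det_le_trace_sub_card_s10 {ι : Type*} [Fintype ι] [DecidableEq ι]
    {M : Matrix ι ι ℝ} (hM : M.PosDef) :
    Real.log M.det ≤ M.trace - Fintype.card ι := by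
  have hdet : M.det = ∏ i, hM.isHermitian.eigenvalues i := by
    simpa using hM.isHermitian.det_eq_prod_eigenvalues
  have htr : M.trace = ∑ i, hM.isHermitian.eigenvalues i := by
    simpa using hM.isHermitian.trace_eq_sum_eigenvalues
  rw [hdet, htr, Real.log_prod fun i _ => (hM.eigenvalues_pos i).ne']
  calc ∑ i, Real.log (hM.isHermitian.eigenvalues i)
      ≤ ∑ i, (hM.isHermitian.eigenvalues i - 1) :=
        Finset.sum_le_sum fun i _ => Real.log_le_sub_one_of_pos (hM.eigenvalues_pos i)
    _ = _ := by simp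

open scoped MatrixOrder Matrix.Norms.L2Operator in
/-- For positive definite real matrices, `log det S + log det X ≤ tr (S X) - n`. -/
theorem Matrix.PosDef.log_det_add_log_det_le_s10 {ι : Type*} [Fintype ι] [DecidableEq ι]
    {S X : Matrix ι ι ℝ} (hS : S.PosDef) (hX : X.PosDef) :
    Real.log S.det + Real.log X.det ≤ (S * X).trace - Fintype.card ι := by
  obtain ⟨B, hB⟩ : ∃ B : Matrix ι ι ℝ, S = Bᴴ * B :=
    CStarAlgebra.nonneg_iff_eq_star_mul_self.mp hS.posSemidef.nonneg
  have hBdet : B.det ≠ 0 := by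
    intro h
    have := hS.det_pos
    simp [hB, h] at this
  have hM : (B * X * Bᴴ).PosDef :=
    hX.mul_mul_conjTranspose_same
      (vecMul_injective_of_isUnit ((isUnit_iff_isUnit_det B).mpr hBdet.isUnit))
  have hdet : (B * X * Bᴴ).det = S.det * X.det := by
    rw [hB]
    simp only [det_mul]
    ring
  have htr : (B * X * Bᴴ).trace = (S * X).trace := by
    rw [trace_mul_comm, ← Matrix.mul_assoc, hB]
  rw [← Real.log_mul hS.det_pos.ne' hX.det_pos.ne', ← hdet, ← htr]
  exact hM.log_det_le_trace_sub_card_s10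

/-- If `Σ` is positive definite, then `eᵀ|X*|e ≤ eᵀ|Σ⁻¹|e` at the optimum. -/
theorem abs_sum_bound_invertible
    (n : ℕ) (hn : 0 < n)
    (Sig : Matrix (Fin n) (Fin n) ℝ) (hSig : Sig.PosDef) (ρ : ℝ) (hρ : 0 < ρ)
    (Xstar : Matrix (Fin n) (Fin n) ℝ) (hXstar : Xstar.PosDef)
    (hopt : ∀ Y : Matrix (Fin n) (Fin n) ℝ, Y.PosDef →
      Real.log Y.det - (Sig * Yᵀ).trace - ρ * ∑ i, ∑ j, |Y i j| ≤
        Real.log Xstar.det - (Sig * Xstarᵀ).trace - ρ * ∑ i, ∑ j, |Xstar i j|) :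
    ∑ i, ∑ j, |Xstar i j| ≤ ∑ i, ∑ j, |Sig⁻¹ i j| := by
  have hinv := hopt Sig⁻¹ hSig.inv
  have hle := hSig.log_det_add_log_det_le_s10 hXstar
  have hXt : Xstarᵀ = Xstar := by simpa using hXstar.isHermitian.eq
  have hSt : (Sig⁻¹)ᵀ = Sig⁻¹ := by simpa using hSig.inv.isHermitian.eq
  rw [hXt, hSt, Matrix.mul_nonsing_inv _ hSig.det_pos.ne'.isUnit, Matrix.trace_one,
    Matrix.det_nonsing_inv, Ring.inverse_eq_inv', Real.log_inv] at hinv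
  refine le_of_mul_le_mul_left ?_ hρ
  linarith
end

section
/- Let A be an n×n real symmetric positive definite matrix. Then A⁻¹ is the unique maximizer of the function X ↦ log det X − ⟨A, X⟩ over the set of symmetric positive definite n×n matrices; that is, for every symmetric positive definite X with X ≠ A⁻¹, log det X − ⟨A, X⟩ < log det(A⁻¹) − n. -/
open Matrix

/-- A Hermitian matrix all of whose eigenvalues are `1` is the identity. -/
lemma Matrix.IsHermitian.eq_one_of_eigenvalues_eq_one {n : Type*} [Fintype n] [DecidableEq n]
    {M : Matrix n n ℝ} (hM : M.IsHermitian) (h : ∀ i, hM.eigenvalues i = 1) : M = 1 := by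
  have hdiag : (RCLike.ofReal ∘ hM.eigenvalues : n → ℝ) = 1 := by
    ext i
    simp [h]
  rw [hM.spectral_theorem, hdiag, show diagonal (1 : n → ℝ) = 1 from diagonal_one, map_one]

/-- For a positive definite matrix `M ≠ 1`, `log det M < tr M - n`. -/
lemma Matrix.PosDef.log_det_lt_trace_sub_card {n : Type*} [Fintype n] [DecidableEq n]
    {M : Matrix n n ℝ} (hM : M.PosDef) (hne : M ≠ 1) :
    Real.log M.det < M.trace - Fintype.card n := by
  have hdet : M.det = ∏ i, hM.1.eigenvalues i := hM.1.det_eq_prod_eigenvalues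
  have htrace : M.trace = ∑ i, hM.1.eigenvalues i := hM.1.trace_eq_sum_eigenvalues
  obtain ⟨i, hi⟩ : ∃ i, hM.1.eigenvalues i ≠ 1 := by
    by_contra! h
    exact hne (hM.1.eq_one_of_eigenvalues_eq_one h)
  calc Real.log M.det = ∑ i, Real.log (hM.1.eigenvalues i) := by
        rw [hdet, Real.log_prod fun i _ => (hM.eigenvalues_pos i).ne']
    _ < ∑ i, (hM.1.eigenvalues i - 1) :=
        Finset.sum_lt_sum (fun j _ => Real.log_le_sub_one_of_pos (hM.eigenvalues_pos j))
          ⟨i, Finset.mem_univ i, Real.log_lt_sub_one_of_pos (hM.eigenvalues_pos i) hi⟩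
    _ = M.trace - Fintype.card n := by simp [htrace]

open scoped MatrixOrder in
/-- A positive definite real matrix factors as `Bᴴ * B` with `B` invertible. -/
lemma Matrix.PosDef.exists_isUnit_eq_conjTranspose_mul_self {n : Type*} [Fintype n]
    [DecidableEq n] {M : Matrix n n ℝ} (hM : M.PosDef) :
    ∃ B : Matrix n n ℝ, IsUnit B ∧ M = Bᴴ * B := by
  obtain ⟨B, hB⟩ := CStarAlgebra.nonneg_iff_eq_star_mul_self.mp hM.posSemidef.nonneg
  exact ⟨B, isUnit_of_mul_isUnit_right (hB ▸ hM.isUnit), hB⟩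

/-- `A⁻¹` is the unique maximizer of `X ↦ log det X − ⟨A, X⟩` over positive definite matrices. -/
theorem inv_unique_maximizer_logdet
    (n : ℕ) (A : Matrix (Fin n) (Fin n) ℝ) (hA : A.PosDef) :
    ∀ X : Matrix (Fin n) (Fin n) ℝ, X.PosDef → X ≠ A⁻¹ →
      Real.log X.det - (A * Xᵀ).trace < Real.log (A⁻¹).det - n := by
  intro X hX hne
  obtain ⟨B, hB, rfl⟩ := hA.exists_isUnit_eq_conjTranspose_mul_self
  have hXT : Xᵀ = X := by simpa using hX.isHermitian.eq
  have hM : (B * X * Bᴴ).PosDef :=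
    hX.mul_mul_conjTranspose_same (Matrix.vecMul_injective_of_isUnit hB)
  have hM1 : B * X * Bᴴ ≠ 1 := by
    intro h
    apply hne
    rw [mul_assoc, mul_eq_one_comm, mul_assoc] at h
    exact (inv_eq_left_inv h).symm
  have hlt := hM.log_det_lt_trace_sub_card hM1
  have hdet : (B * X * Bᴴ).det = (Bᴴ * B).det * X.det := by
    simp only [det_mul]
    ring
  have htrace : (B * X * Bᴴ).trace = (Bᴴ * B * X).trace := trace_mul_cycle B X Bᴴ
  rw [hdet, htrace, Real.log_mul hA.det_pos.ne' hX.det_pos.ne', Fintype.card_fin] at hlt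
  rw [hXT, det_nonsing_inv, Ring.inverse_eq_inv', Real.log_inv]
  linarith
end

section
/- Let 0 < α < β and let 𝒳 := {X ∈ S^n : αI ⪯ X ⪯ βI}. Let A₁ and A₂ be n×n real symmetric matrices, and suppose X₁ maximizes X ↦ log det X − ⟨A₁, X⟩ over 𝒳 and X₂ maximizes X ↦ log det X − ⟨A₂, X⟩ over 𝒳. Then ‖X₁ − X₂‖_F ≤ β²·‖A₁ − A₂‖_F. -/
open Matrix

namespace Matrix

open scoped MatrixOrder Matrix.Norms.L2Operator in
theorem PosSemidef.exists_eq_conjTranspose_mul_self {n : Type*} [Fintype n] [DecidableEq n]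
    {P : Matrix n n ℝ} (hP : P.PosSemidef) : ∃ B : Matrix n n ℝ, P = Bᴴ * B :=
  CStarAlgebra.nonneg_iff_eq_star_mul_self.mp hP.nonneg

/-- `log det` of a positive definite matrix is at most its trace minus the dimension. -/
theorem PosDef.log_det_le_trace_sub_one {n : Type*} [Fintype n] [DecidableEq n]
    {Z : Matrix n n ℝ} (hZ : Z.PosDef) :
    Real.log Z.det ≤ (Z - 1).trace := by
  have hdet := hZ.isHermitian.det_eq_prod_eigenvalues
  have htr := hZ.isHermitian.trace_eq_sum_eigenvalues
  simp only [RCLike.ofReal_real_eq_id, id_eq] at hdet htr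
  rw [trace_sub, trace_one, htr, hdet, Real.log_prod fun i _ => (hZ.eigenvalues_pos i).ne']
  calc ∑ i, Real.log (hZ.isHermitian.eigenvalues i)
      ≤ ∑ i, (hZ.isHermitian.eigenvalues i - 1) :=
        Finset.sum_le_sum fun i _ => Real.log_le_sub_one_of_pos (hZ.eigenvalues_pos i)
    _ = _ := by simp

/-- The tangent inequality for the concave function `log det`. -/
theorem PosDef.log_det_le_log_det_add_trace {n : Type*} [Fintype n] [DecidableEq n]
    {X Y : Matrix n n ℝ} (hX : X.PosDef) (hY : Y.PosDef) :
    Real.log X.det ≤ Real.log Y.det + (Y⁻¹ * (X - Y)).trace := by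
  obtain ⟨B, hB, hYB⟩ : ∃ B : Matrix n n ℝ, IsUnit B ∧ Y⁻¹ = Bᴴ * B := by
    obtain ⟨B, hYB⟩ := hY.inv.posSemidef.exists_eq_conjTranspose_mul_self
    refine ⟨B, ?_, hYB⟩
    have h := hY.inv.det_pos.ne'
    rw [hYB, det_mul] at h
    exact (isUnit_iff_isUnit_det B).mpr (right_ne_zero_of_mul h).isUnit
  have hZ : (B * X * Bᴴ).PosDef :=
    hX.mul_mul_conjTranspose_same (vecMul_injective_of_isUnit hB)
  have hdet : (B * X * Bᴴ).det = X.det / Y.det := by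
    have h : (Y⁻¹).det = Bᴴ.det * B.det := by rw [hYB, det_mul]
    rw [det_nonsing_inv, Ring.inverse_eq_inv'] at h
    rw [det_mul, det_mul, div_eq_mul_inv, h]
    ring
  have htr : (B * X * Bᴴ - 1).trace = (Y⁻¹ * (X - Y)).trace := by
    rw [mul_sub, nonsing_inv_mul _ hY.det_pos.ne'.isUnit, hYB, trace_sub, trace_sub,
      trace_mul_comm, ← mul_assoc]
  have h := hZ.log_det_le_trace_sub_one
  rw [htr, hdet, Real.log_div hX.det_pos.ne' hY.det_pos.ne'] at h
  linarith

/-- The trace of a product of two positive semidefinite matrices is nonnegative. -/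
theorem PosSemidef.trace_mul_nonneg {n : Type*} [Fintype n] [DecidableEq n]
    {P M : Matrix n n ℝ} (hP : P.PosSemidef) (hM : M.PosSemidef) :
    0 ≤ (P * M).trace := by
  obtain ⟨B, rfl⟩ := hP.exists_eq_conjTranspose_mul_self
  rw [mul_assoc, trace_mul_comm]
  exact (hM.mul_mul_conjTranspose_same B).trace_nonneg

theorem PosDef.posSemidef_inv_sub_smul_one {n : Type*} [Fintype n] [DecidableEq n]
    {Y : Matrix n n ℝ} {β : ℝ} (hβ : 0 < β)
    (hY : Y.PosDef) (hYβ : (β • (1 : Matrix n n ℝ) - Y).PosSemidef) :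
    (Y⁻¹ - β⁻¹ • (1 : Matrix n n ℝ)).PosSemidef := by
  have hH : (Y⁻¹ - β⁻¹ • (1 : Matrix n n ℝ)).IsHermitian :=
    hY.inv.isHermitian.sub (by simp [IsHermitian])
  have h₁ : ((Y⁻¹ - β⁻¹ • (1 : Matrix n n ℝ)) * Y *
      (Y⁻¹ - β⁻¹ • (1 : Matrix n n ℝ))).PosSemidef := by
    have h := hY.posSemidef.mul_mul_conjTranspose_same (Y⁻¹ - β⁻¹ • (1 : Matrix n n ℝ))
    rwa [hH.eq] at h
  have h₂ := h₁.add (hYβ.smul (by positivity : 0 ≤ β⁻¹ ^ 2))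
  have hu := hY.det_pos.ne'.isUnit
  convert h₂ using 1
  simp only [sub_mul, mul_sub, nonsing_inv_mul _ hu, mul_nonsing_inv _ hu, smul_mul_assoc,
    mul_smul_comm, one_mul, mul_one, smul_sub, smul_smul]
  have : β⁻¹ ^ 2 * β = β⁻¹ := by field_simp
  rw [this, pow_two]
  abel

/-- Strong monotonicity of inversion on positive definite matrices bounded above by `β`. -/
theorem sq_inv_mul_trace_le_trace_inv_mul {n : Type*} [Fintype n] [DecidableEq n]
    {Y W D : Matrix n n ℝ} {β : ℝ} (hβ : 0 < β)
    (hY : Y.PosDef) (hYβ : (β • (1 : Matrix n n ℝ) - Y).PosSemidef)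
    (hW : W.PosDef) (hWβ : (β • (1 : Matrix n n ℝ) - W).PosSemidef) (hD : D.IsHermitian) :
    β⁻¹ ^ 2 * (D * D).trace ≤ (Y⁻¹ * D * W⁻¹ * D).trace := by
  have hsand {Q : Matrix n n ℝ} (hQ : Q.PosSemidef) : (D * Q * D).PosSemidef := by
    simpa only [hD.eq] using hQ.mul_mul_conjTranspose_same D
  have h₁ := (hY.posSemidef_inv_sub_smul_one hβ hYβ).trace_mul_nonneg
    (hsand hW.inv.posSemidef)
  have h₂ := (hsand (hW.posSemidef_inv_sub_smul_one hβ hWβ)).trace_nonneg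
  simp only [sub_mul, mul_sub, smul_mul_assoc, mul_smul_comm, one_mul, mul_one, trace_sub,
    trace_smul, smul_eq_mul, ← mul_assoc] at h₁ h₂
  have h₃ := mul_nonneg (inv_pos.mpr hβ).le h₂
  nlinarith

theorem posDef_of_posSemidef_sub_smul_one {n : Type*} [DecidableEq n]
    {X : Matrix n n ℝ} {α : ℝ} (hα : 0 < α)
    (h : (X - α • (1 : Matrix n n ℝ)).PosSemidef) : X.PosDef := by
  simpa using (PosDef.one.smul hα).add_posSemidef h

/-- Interpolated first-order optimality condition for maximizing `log det X - ⟨A, X⟩`. -/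
theorem trace_inv_mul_le_of_log_det_le {n : Type*} [Fintype n] [DecidableEq n]
    {A X Y D : Matrix n n ℝ} {t : ℝ} (ht : 0 < t)
    (hX : X.PosDef) (hY : Y.PosDef) (hYX : Y = X + t • D)
    (hopt : Real.log Y.det - (A * Yᵀ).trace ≤ Real.log X.det - (A * Xᵀ).trace) :
    (Y⁻¹ * D).trace ≤ (A * Dᵀ).trace := by
  have h := hX.log_det_le_log_det_add_trace hY
  have hsub : X - Y = -(t • D) := by rw [hYX]; abel
  have hA : (A * Yᵀ).trace = (A * Xᵀ).trace + t * (A * Dᵀ).trace := by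
    simp [hYX, mul_add]
  rw [hsub] at h
  simp only [mul_neg, mul_smul_comm, trace_neg, trace_smul, smul_eq_mul] at h
  exact le_of_mul_le_mul_left (by linarith) ht

theorem trace_mul_transpose_le_sqrt_mul_sqrt {m n : Type*} [Fintype m] [Fintype n]
    (E D : Matrix m n ℝ) :
    (E * Dᵀ).trace ≤ √(∑ i, ∑ j, E i j ^ 2) * √(∑ i, ∑ j, D i j ^ 2) := by
  simp only [trace, diag, mul_apply, transpose_apply, ← Fintype.sum_prod_type']
  exact Real.sum_mul_le_sqrt_mul_sqrt _ _ _

end Matrix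

/-- Lipschitz dependence of the maximizer of `X ↦ log det X − ⟨A, X⟩` over
`𝒳 = {X : αI ⪯ X ⪯ βI}` on `A`: `‖X₁ − X₂‖_F ≤ β² ‖A₁ − A₂‖_F`. -/
theorem maximizer_lipschitz
    (n : ℕ) (α β : ℝ) (hα : 0 < α) (hαβ : α < β)
    (A₁ A₂ X₁ X₂ : Matrix (Fin n) (Fin n) ℝ)
    (hA₁ : A₁.IsHermitian) (hA₂ : A₂.IsHermitian)
    (𝒳 : Set (Matrix (Fin n) (Fin n) ℝ))
    (h𝒳 : 𝒳 = {X | X.IsHermitian ∧ (X - α • (1 : Matrix (Fin n) (Fin n) ℝ)).PosSemidef ∧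
      (β • (1 : Matrix (Fin n) (Fin n) ℝ) - X).PosSemidef})
    (hX₁ : X₁ ∈ 𝒳) (hX₂ : X₂ ∈ 𝒳)
    (hopt₁ : ∀ Y ∈ 𝒳, Real.log Y.det - (A₁ * Yᵀ).trace ≤ Real.log X₁.det - (A₁ * X₁ᵀ).trace)
    (hopt₂ : ∀ Y ∈ 𝒳, Real.log Y.det - (A₂ * Yᵀ).trace ≤ Real.log X₂.det - (A₂ * X₂ᵀ).trace) :
    Real.sqrt (∑ i, ∑ j, (X₁ i j - X₂ i j) ^ 2) ≤
      β ^ 2 * Real.sqrt (∑ i, ∑ j, (A₁ i j - A₂ i j) ^ 2) := by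
  have hβ : 0 < β := hα.trans hαβ
  have hconv : Convex ℝ 𝒳 := by
    intro X hX Y hY a b ha hb hab
    obtain rfl := eq_sub_of_add_eq hab
    rw [h𝒳] at hX hY ⊢
    obtain ⟨hX, hXα, hXβ⟩ := hX
    obtain ⟨hY, hYα, hYβ⟩ := hY
    refine ⟨?_, ?_, ?_⟩
    · exact (hX.smul (IsSelfAdjoint.all _)).add (hY.smul (IsSelfAdjoint.all _))
    · convert (hXα.smul ha).add (hYα.smul hb) using 1
      module
    · convert (hXβ.smul ha).add (hYβ.smul hb) using 1
      module
  have hherm {X} (hX : X ∈ 𝒳) : X.IsHermitian := by rw [h𝒳] at hX; exact hX.1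
  have hpos {X} (hX : X ∈ 𝒳) : X.PosDef := by
    rw [h𝒳] at hX; exact posDef_of_posSemidef_sub_smul_one hα hX.2.1
  have hle {X} (hX : X ∈ 𝒳) : (β • (1 : Matrix (Fin n) (Fin n) ℝ) - X).PosSemidef := by
    rw [h𝒳] at hX; exact hX.2.2
  set D := X₁ - X₂ with hD
  have hDH : D.IsHermitian := (hherm hX₁).sub (hherm hX₂)
  have hkey (t : ℝ) (ht : 0 < t) (ht2 : t < 1 / 2) :
      (1 - 2 * t) * (β⁻¹ ^ 2 * (D * D).trace) ≤ ((A₂ - A₁) * Dᵀ).trace := by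
    obtain ⟨Y, hYdef⟩ : ∃ Y, Y = X₁ + t • -D := ⟨_, rfl⟩
    obtain ⟨W, hWdef⟩ : ∃ W, W = X₂ + t • D := ⟨_, rfl⟩
    have hY : Y ∈ 𝒳 := by
      have h := hconv hX₁ hX₂ (by linarith : 0 ≤ 1 - t) ht.le (by ring)
      convert h using 1
      rw [hYdef, hD]; module
    have hW : W ∈ 𝒳 := by
      have h := hconv hX₁ hX₂ ht.le (by linarith : 0 ≤ 1 - t) (by ring)
      convert h using 1
      rw [hWdef, hD]; module
    have h₁ := trace_inv_mul_le_of_log_det_le ht (hpos hX₁) (hpos hY) hYdef (hopt₁ Y hY)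
    have h₂ := trace_inv_mul_le_of_log_det_le ht (hpos hX₂) (hpos hW) hWdef (hopt₂ W hW)
    have h₃ := sq_inv_mul_trace_le_trace_inv_mul hβ (hpos hY) (hle hY) (hpos hW) (hle hW) hDH
    have hYu := (hpos hY).det_pos.ne'.isUnit
    have hWu := (hpos hW).det_pos.ne'.isUnit
    have hinv : W⁻¹ - Y⁻¹ = (1 - 2 * t) • (Y⁻¹ * D * W⁻¹) := by
      have hYW : (1 - 2 * t) • D = Y - W := by rw [hYdef, hWdef, hD]; module
      rw [← smul_mul_assoc, ← mul_smul_comm, hYW, mul_sub, sub_mul, nonsing_inv_mul _ hYu,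
        one_mul, mul_assoc, mul_nonsing_inv _ hWu, mul_one]
    have h₄ : (W⁻¹ * D).trace - (Y⁻¹ * D).trace =
        (1 - 2 * t) * (Y⁻¹ * D * W⁻¹ * D).trace := by
      rw [← trace_sub, ← sub_mul, hinv, smul_mul_assoc, trace_smul, smul_eq_mul]
    have h₅ := mul_le_mul_of_nonneg_left h₃ (by linarith : 0 ≤ 1 - 2 * t)
    simp only [mul_neg, transpose_neg, trace_neg] at h₁
    rw [Matrix.sub_mul A₂, trace_sub]
    linarith
  have hlim : β⁻¹ ^ 2 * (D * D).trace ≤ ((A₂ - A₁) * Dᵀ).trace := by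
    have hcont : Filter.Tendsto (fun t : ℝ => (1 - 2 * t) * (β⁻¹ ^ 2 * (D * D).trace))
        (nhdsWithin 0 (Set.Ioi 0)) (nhds ((1 - 2 * 0) * (β⁻¹ ^ 2 * (D * D).trace))) :=
      (Continuous.tendsto (by fun_prop) 0).mono_left nhdsWithin_le_nhds
    rw [mul_zero, sub_zero, one_mul] at hcont
    refine le_of_tendsto hcont ?_
    filter_upwards [Ioo_mem_nhdsGT (by norm_num : (0 : ℝ) < 1 / 2)] with t ht
    exact hkey t ht.1 ht.2
  have htr : (D * D).trace = √(∑ i, ∑ j, (X₁ i j - X₂ i j) ^ 2) ^ 2 := by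
    rw [Real.sq_sqrt (by positivity)]
    have hDT : D * D = D * Dᵀ := by rw [← conjTranspose_eq_transpose_of_trivial, hDH.eq]
    rw [hDT]
    simp [trace, mul_apply, hD, pow_two]
  have hcs := trace_mul_transpose_le_sqrt_mul_sqrt (A₂ - A₁) D
  have hE : ∑ i, ∑ j, (A₂ - A₁) i j ^ 2 = ∑ i, ∑ j, (A₁ i j - A₂ i j) ^ 2 :=
    Finset.sum_congr rfl fun i _ => Finset.sum_congr rfl fun j _ => sub_sq_comm _ _
  rw [hE] at hcs
  have hF : ∑ i, ∑ j, D i j ^ 2 = ∑ i, ∑ j, (X₁ i j - X₂ i j) ^ 2 := rfl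
  rw [hF] at hcs
  rw [htr] at hlim
  set d := √(∑ i, ∑ j, (X₁ i j - X₂ i j) ^ 2)
  set e := √(∑ i, ∑ j, (A₁ i j - A₂ i j) ^ 2)
  have hd : 0 ≤ d := Real.sqrt_nonneg _
  have he : 0 ≤ e := Real.sqrt_nonneg _
  rcases hd.eq_or_lt with h0 | hd
  · rw [← h0]; positivity
  have hmul : β⁻¹ ^ 2 * d * d ≤ e * d := by linarith
  have h := le_of_mul_le_mul_right hmul hd
  rw [inv_pow, inv_mul_le_iff₀ (by positivity)] at h
  exact h
end

section
/- Let 0 < α < β and let 𝒳 := {X ∈ S^n : αI ⪯ X ⪯ βI}. Let A ∈ S^n have an eigenvalue decomposition A = Q·diag(γ)·Qᵀ with QQᵀ = I. For i = 1,…,n define λ_i := min{max{1/γ_i, α}, β} if γ_i > 0, and λ_i := β otherwise. Then X := Q·diag(λ)·Qᵀ is the unique maximizer of X ↦ log det X − ⟨A, X⟩ over 𝒳, and the maximal value equals −γᵀλ + Σ_{i=1}^{n} log λ_i. -/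
open Matrix

/-- For a positive definite real matrix, `log det W ≤ tr W − n`, with equality only at `W = 1`. -/
theorem Matrix.PosDef.log_det_le_trace_sub_card_s15 {ι : Type*} [Fintype ι] [DecidableEq ι]
    {W : Matrix ι ι ℝ} (hW : W.PosDef) :
    Real.log W.det ≤ W.trace - Fintype.card ι ∧
      (Real.log W.det = W.trace - Fintype.card ι → W = 1) := by
  have hpos := hW.eigenvalues_pos
  have hdet : Real.log W.det = ∑ i, Real.log (hW.isHermitian.eigenvalues i) := by
    rw [hW.isHermitian.det_eq_prod_eigenvalues, ← Real.log_prod fun i _ => (hpos i).ne']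
    simp
  have htr : W.trace - Fintype.card ι = ∑ i, (hW.isHermitian.eigenvalues i - 1) := by
    rw [hW.isHermitian.trace_eq_sum_eigenvalues]
    simp
  have hle : ∀ i ∈ Finset.univ, Real.log (hW.isHermitian.eigenvalues i) ≤
      hW.isHermitian.eigenvalues i - 1 := fun i _ => Real.log_le_sub_one_of_pos (hpos i)
  rw [hdet, htr]
  refine ⟨Finset.sum_le_sum hle, fun heq => ?_⟩
  have hone : hW.isHermitian.eigenvalues = fun _ => 1 := by
    funext i
    by_contra hne
    exact (Real.log_lt_sub_one_of_pos (hpos i) hne).ne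
      ((Finset.sum_eq_sum_iff_of_le hle).1 heq i (Finset.mem_univ i))
  rw [hW.isHermitian.spectral_theorem, hone]
  have : diagonal ((RCLike.ofReal : ℝ → ℝ) ∘ fun _ : ι => (1 : ℝ)) = 1 := by
    ext i j
    simp [diagonal, one_apply]
  rw [this, map_one]

/-- The first-order upper bound of `log det` at a positive diagonal matrix, with its equality
case. -/
theorem Matrix.PosDef.log_det_le_of_diagonal {ι : Type*} [Fintype ι] [DecidableEq ι]
    {Z : Matrix ι ι ℝ} (hZ : Z.PosDef) {l : ι → ℝ} (hl : ∀ i, 0 < l i) :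
    Real.log Z.det ≤ ∑ i, (Real.log (l i) + (Z i i / l i - 1)) ∧
      (Real.log Z.det = ∑ i, (Real.log (l i) + (Z i i / l i - 1)) → Z = diagonal l) := by
  set D : Matrix ι ι ℝ := diagonal fun i => (√(l i))⁻¹ with hD
  have hs : ∀ i, √(l i) ≠ 0 := fun i => (Real.sqrt_pos.2 (hl i)).ne'
  have hDu : IsUnit D := by
    rw [isUnit_iff_isUnit_det, hD, det_diagonal, isUnit_iff_ne_zero]
    exact Finset.prod_ne_zero_iff.2 fun i _ => inv_ne_zero (hs i)
  have hDH : Dᴴ = D := by simp [hD]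
  have hW : (D * Z * D).PosDef := by
    have := hZ.conjTranspose_mul_mul_same (B := D) (mulVec_injective_of_isUnit hDu)
    rwa [hDH] at this
  have happ : ∀ i j, (D * Z * D) i j = (√(l i))⁻¹ * Z i j * (√(l j))⁻¹ := by
    intro i j
    simp [hD, diagonal_mul, mul_diagonal]
  have htr : (D * Z * D).trace = ∑ i, Z i i / l i := by
    refine Finset.sum_congr rfl fun i _ => ?_
    rw [diag_apply, happ]
    have := Real.mul_self_sqrt (hl i).le
    nth_rewrite 3 [← this]
    field_simp [hs i]
  have hdet : Real.log (D * Z * D).det = Real.log Z.det - ∑ i, Real.log (l i) := by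
    have hDd : D.det * D.det = (∏ i, l i)⁻¹ := by
      rw [hD, det_diagonal, ← Finset.prod_mul_distrib, ← Finset.prod_inv_distrib]
      refine Finset.prod_congr rfl fun i _ => ?_
      rw [← mul_inv, Real.mul_self_sqrt (hl i).le]
    have hp : ∏ i, l i ≠ 0 := Finset.prod_ne_zero_iff.2 fun i _ => (hl i).ne'
    rw [det_mul, det_mul, mul_right_comm, hDd, Real.log_mul (inv_ne_zero hp) hZ.det_pos.ne',
      Real.log_inv, Real.log_prod fun i _ => (hl i).ne']
    ring
  have hsum : ∑ i, (Real.log (l i) + (Z i i / l i - 1)) =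
      ∑ i, Real.log (l i) + (∑ i, Z i i / l i - Fintype.card ι) := by
    simp [Finset.sum_add_distrib]
  obtain ⟨hle, heq⟩ := hW.log_det_le_trace_sub_card_s15
  rw [hdet, htr] at hle heq
  rw [hsum]
  refine ⟨by linarith, fun h => ?_⟩
  have h1 := heq (by linarith)
  ext i j
  have hij := happ i j
  rw [h1] at hij
  by_cases h : i = j
  · subst h
    have hsq := Real.mul_self_sqrt (hl i).le
    have hi := hs i
    rw [one_apply_eq] at hij
    rw [diagonal_apply_eq, ← hsq]
    field_simp at hij
    linarith
  · rw [one_apply_ne h] at hij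
    rw [diagonal_apply_ne _ h]
    simpa [hs i, hs j] using hij.symm

/-- First-order optimality of the clipped value `l` for `z ↦ log z − g z` on `[α, β]`. -/
theorem div_sub_one_le_of_clipped {α β g l z : ℝ} (hα : 0 < α) (hαβ : α < β)
    (hl : l = if 0 < g then min (max (1 / g) α) β else β) (hz : α ≤ z) (hz' : z ≤ β) :
    z / l - 1 ≤ g * z - g * l := by
  have key : 0 < l → (z - l) * (1 - g * l) ≤ 0 → z / l - 1 ≤ g * z - g * l := by
    intro hl0 h
    have : z / l - 1 - (g * z - g * l) = (z - l) * (1 - g * l) / l := by field_simp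
    have := div_nonpos_of_nonpos_of_nonneg h hl0.le
    linarith
  split_ifs at hl with hg
  · have hg1 : g * (1 / g) = 1 := by field_simp
    rcases le_total (1 / g) α with h1 | h1
    · rw [max_eq_right h1, min_eq_left hαβ.le] at hl
      subst hl
      exact key hα (mul_nonpos_of_nonneg_of_nonpos (by linarith) (by nlinarith))
    · rw [max_eq_left h1] at hl
      rcases le_total (1 / g) β with h2 | h2
      · rw [min_eq_left h2] at hl
        exact key (by linarith) (by rw [hl, hg1]; simp)
      · rw [min_eq_right h2] at hl
        subst hl
        exact key (by linarith) (mul_nonpos_of_nonpos_of_nonneg (by linarith) (by nlinarith))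
  · subst hl
    exact key (by linarith) (mul_nonpos_of_nonpos_of_nonneg (by linarith) (by nlinarith))

/-- Closed-form solution of `max { log det X − ⟨A, X⟩ : αI ⪯ X ⪯ βI }` via an eigenvalue
decomposition `A = Q diag(γ) Qᵀ`: the unique maximizer is `X = Q diag(λ) Qᵀ` with
`λᵢ = min{max{1/γᵢ, α}, β}` when `γᵢ > 0` and `λᵢ = β` otherwise, and the optimal value is
`−γᵀλ + Σᵢ log λᵢ`. -/
theorem closed_form_projection_logdet
    (n : ℕ) (α β : ℝ) (hα : 0 < α) (hαβ : α < β)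
    (A Q : Matrix (Fin n) (Fin n) ℝ) (γ : Fin n → ℝ)
    (hdecomp : A = Q * Matrix.diagonal γ * Qᵀ) (hQ : Q * Qᵀ = 1)
    (lam : Fin n → ℝ)
    (hlam : ∀ i, lam i = if 0 < γ i then min (max (1 / γ i) α) β else β)
    (𝒳 : Set (Matrix (Fin n) (Fin n) ℝ))
    (h𝒳 : 𝒳 = {X | X.IsHermitian ∧ (X - α • (1 : Matrix (Fin n) (Fin n) ℝ)).PosSemidef ∧
      (β • (1 : Matrix (Fin n) (Fin n) ℝ) - X).PosSemidef})
    (X : Matrix (Fin n) (Fin n) ℝ) (hX : X = Q * Matrix.diagonal lam * Qᵀ) :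
    X ∈ 𝒳 ∧
      (∀ Y ∈ 𝒳, Real.log Y.det - (A * Yᵀ).trace ≤ Real.log X.det - (A * Xᵀ).trace) ∧
      (∀ Y ∈ 𝒳, Real.log Y.det - (A * Yᵀ).trace = Real.log X.det - (A * Xᵀ).trace → Y = X) ∧
      Real.log X.det - (A * Xᵀ).trace = -(∑ i, γ i * lam i) + ∑ i, Real.log (lam i) := by
  have hQ' : Qᵀ * Q = 1 := mul_eq_one_comm.1 hQ
  have hlα : ∀ i, α ≤ lam i := fun i => by
    rw [hlam]
    split_ifs
    · exact le_min (le_max_right _ _) hαβ.le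
    · exact hαβ.le
  have hlβ : ∀ i, lam i ≤ β := fun i => by
    rw [hlam]
    split_ifs
    · exact min_le_right _ _
    · exact le_rfl
  have hl : ∀ i, 0 < lam i := fun i => hα.trans_le (hlα i)
  have hdetQ : Q.det * Q.det = 1 := by
    have := congrArg det hQ
    rwa [det_mul, det_transpose, det_one] at this
  have hpsd : ∀ d : Fin n → ℝ, (∀ i, 0 ≤ d i) → (Q * diagonal d * Qᵀ).PosSemidef := by
    intro d hd
    have := (PosSemidef.diagonal (d := d) hd).mul_mul_conjTranspose_same Q
    rwa [conjTranspose_eq_transpose_of_trivial] at this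
  have hsmul : ∀ c : ℝ, c • (1 : Matrix (Fin n) (Fin n) ℝ) =
      Q * diagonal (fun _ => c) * Qᵀ := by
    intro c
    rw [← smul_one_eq_diagonal, Matrix.mul_smul, mul_one, Matrix.smul_mul, hQ]
  have htrace : ∀ Y : Matrix (Fin n) (Fin n) ℝ, Y.IsHermitian →
      (A * Yᵀ).trace = ∑ i, γ i * (Qᵀ * Y * Q) i i := by
    intro Y hY
    have hYt : Yᵀ = Y := by
      rw [← conjTranspose_eq_transpose_of_trivial]
      exact hY
    rw [hYt, hdecomp, mul_assoc, mul_assoc, trace_mul_comm, mul_assoc, trace]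
    simp only [diag_apply, diagonal_mul, mul_assoc]
  have hdet : ∀ Y : Matrix (Fin n) (Fin n) ℝ, (Qᵀ * Y * Q).det = Y.det := by
    intro Y
    rw [det_mul, det_mul, det_transpose, mul_right_comm, hdetQ, one_mul]
  have hXc : Qᵀ * X * Q = diagonal lam := by
    rw [hX]
    calc Qᵀ * (Q * diagonal lam * Qᵀ) * Q = Qᵀ * Q * diagonal lam * (Qᵀ * Q) := by
          simp only [mul_assoc]
      _ = diagonal lam := by rw [hQ', one_mul, mul_one]
  have hXH : X.IsHermitian := by
    rw [hX]
    exact (hpsd lam fun i => (hl i).le).isHermitian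
  have hval : Real.log X.det - (A * Xᵀ).trace =
      -(∑ i, γ i * lam i) + ∑ i, Real.log (lam i) := by
    rw [htrace X hXH, ← hdet X, hXc, det_diagonal, Real.log_prod fun i _ => (hl i).ne']
    simp only [diagonal_apply_eq]
    ring
  have hmem : X ∈ 𝒳 := by
    rw [h𝒳]
    refine ⟨hXH, ?_, ?_⟩
    · rw [hX, hsmul, ← sub_mul, ← mul_sub, diagonal_sub]
      exact hpsd _ fun i => sub_nonneg.2 (hlα i)
    · rw [hX, hsmul, ← sub_mul, ← mul_sub, diagonal_sub]
      exact hpsd _ fun i => sub_nonneg.2 (hlβ i)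
  have hmain : ∀ Y ∈ 𝒳, Real.log Y.det - (A * Yᵀ).trace ≤ Real.log X.det - (A * Xᵀ).trace ∧
      (Real.log Y.det - (A * Yᵀ).trace = Real.log X.det - (A * Xᵀ).trace → Y = X) := by
    intro Y hY
    rw [h𝒳] at hY
    obtain ⟨hYH, hYα, hYβ⟩ := hY
    have hconj : ∀ B : Matrix (Fin n) (Fin n) ℝ, B.PosSemidef → (Qᵀ * B * Q).PosSemidef := by
      intro B hB
      have := hB.conjTranspose_mul_mul_same Q
      rwa [conjTranspose_eq_transpose_of_trivial] at this
    have hZα := hconj _ hYα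
    have hZβ := hconj _ hYβ
    have hconj1 : ∀ c : ℝ, Qᵀ * (c • (1 : Matrix (Fin n) (Fin n) ℝ)) * Q = c • 1 := by
      intro c
      rw [Matrix.mul_smul, mul_one, Matrix.smul_mul, hQ']
    rw [mul_sub, sub_mul, hconj1] at hZα hZβ
    set Z := Qᵀ * Y * Q with hZdef
    have hZ : Z.PosDef := by
      have := (PosDef.one (n := Fin n) (R := ℝ)).smul hα
      have := PosDef.add_posSemidef this hZα
      rwa [add_sub_cancel] at this
    have hz1 : ∀ i, α ≤ Z i i := fun i => by
      have := hZα.diag_nonneg (i := i)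
      simpa using this
    have hz2 : ∀ i, Z i i ≤ β := fun i => by
      have := hZβ.diag_nonneg (i := i)
      simpa using this
    obtain ⟨hle, heq⟩ := hZ.log_det_le_of_diagonal hl
    have hsum : ∑ i, (Real.log (lam i) + (Z i i / lam i - 1)) ≤
        ∑ i, (Real.log (lam i) + (γ i * Z i i - γ i * lam i)) :=
      Finset.sum_le_sum fun i _ => add_le_add_right
        (div_sub_one_le_of_clipped hα hαβ (hlam i) (hz1 i) (hz2 i)) _
    have hexp : ∑ i, (Real.log (lam i) + (γ i * Z i i - γ i * lam i)) =
        ∑ i, Real.log (lam i) + (∑ i, γ i * Z i i - ∑ i, γ i * lam i) := by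
      rw [Finset.sum_add_distrib, Finset.sum_sub_distrib]
    rw [hval, htrace Y hYH, ← hdet Y, ← hZdef]
    refine ⟨by linarith, fun h => ?_⟩
    have hZl := heq (by linarith)
    rw [hX, ← hZl, hZdef]
    calc Y = Q * Qᵀ * Y * (Q * Qᵀ) := by rw [hQ, one_mul, mul_one]
      _ = Q * (Qᵀ * Y * Q) * Qᵀ := by simp only [mul_assoc]
  exact ⟨hmem, fun Y hY => (hmain Y hY).1, fun Y hY => (hmain Y hY).2, hval⟩
end

section
/- The function U₀ ↦ max_{U∈𝒰} ‖U − U₀‖_F, defined for U₀ ∈ 𝒰, attains its minimum over 𝒰 uniquely at U₀ = 0, and its minimum value is max_{U∈𝒰} ‖U‖_F = n. -/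
open Matrix

/-- Over symmetric matrices with entries in `[-1, 1]`, the Frobenius norm is at most `n`, and this
bound is attained. -/
theorem isGreatest_frobenius_image_symm_unit_box (n : ℕ) :
    IsGreatest ((fun U : Matrix (Fin n) (Fin n) ℝ => Real.sqrt (∑ i, ∑ j, (U i j) ^ 2)) ''
      {U | U.IsSymm ∧ ∀ i j, |U i j| ≤ 1}) (n : ℝ) := by
  have hsum : ∑ _i : Fin n, ∑ _j : Fin n, (1 : ℝ) = (n : ℝ) ^ 2 := by
    simp [sq]
  constructor
  · refine ⟨Matrix.of fun _ _ => 1, ⟨by ext; simp, by simp⟩, ?_⟩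
    simp only [Matrix.of_apply, one_pow, hsum]
    exact Real.sqrt_sq n.cast_nonneg
  · rintro _ ⟨U, ⟨-, hU⟩, rfl⟩
    refine Real.sqrt_le_iff.mpr ⟨n.cast_nonneg, ?_⟩
    rw [← hsum]
    exact Finset.sum_le_sum fun i _ => Finset.sum_le_sum fun j _ =>
      (sq_le_one_iff_abs_le_one _).mpr (hU i j)

/-- Frobenius distances from a fixed point of the symmetric unit box to the box are bounded. -/
theorem bddAbove_frobenius_dist_symm_unit_box {n : ℕ} {U₀ : Matrix (Fin n) (Fin n) ℝ}
    (hU₀ : ∀ i j, |U₀ i j| ≤ 1) :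
    BddAbove ((fun U : Matrix (Fin n) (Fin n) ℝ =>
      Real.sqrt (∑ i, ∑ j, (U i j - U₀ i j) ^ 2)) '' {U | U.IsSymm ∧ ∀ i j, |U i j| ≤ 1}) := by
  refine ⟨Real.sqrt (∑ _i : Fin n, ∑ _j : Fin n, 4), ?_⟩
  rintro _ ⟨U, ⟨-, hU⟩, rfl⟩
  refine Real.sqrt_le_sqrt (Finset.sum_le_sum fun i _ => Finset.sum_le_sum fun j _ => ?_)
  have h₁ := abs_le.mp (hU i j)
  have h₂ := abs_le.mp (hU₀ i j)
  nlinarith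

/-- Some symmetric sign matrix lies at Frobenius distance more than `n` from a given nonzero
symmetric matrix. -/
theorem exists_lt_frobenius_dist_of_ne_zero {n : ℕ} {U₀ : Matrix (Fin n) (Fin n) ℝ}
    (hs : U₀.IsSymm) (h0 : U₀ ≠ 0) :
    ∃ U : Matrix (Fin n) (Fin n) ℝ, (U.IsSymm ∧ ∀ i j, |U i j| ≤ 1) ∧
      (n : ℝ) < Real.sqrt (∑ i, ∑ j, (U i j - U₀ i j) ^ 2) := by
  refine ⟨Matrix.of fun i j => if U₀ i j ≤ 0 then 1 else -1, ⟨?_, ?_⟩, ?_⟩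
  · ext i j
    simp [hs.apply i j]
  · intro i j
    rw [Matrix.of_apply]
    split_ifs <;> simp
  · have hentry : ∀ i j, 1 + (U₀ i j) ^ 2 ≤
        ((Matrix.of fun i j => if U₀ i j ≤ 0 then (1 : ℝ) else -1) i j - U₀ i j) ^ 2 := by
      intro i j
      rw [Matrix.of_apply]
      split_ifs <;> nlinarith
    have hpos : 0 < ∑ i, ∑ j, (U₀ i j) ^ 2 := by
      obtain ⟨i, j, hij⟩ : ∃ i j, U₀ i j ≠ 0 := by
        by_contra! h
        exact h0 (Matrix.ext h)
      exact Finset.sum_pos' (fun i _ => Finset.sum_nonneg fun j _ => sq_nonneg _)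
        ⟨i, Finset.mem_univ i, Finset.sum_pos' (fun j _ => sq_nonneg _)
          ⟨j, Finset.mem_univ j, by positivity⟩⟩
    refine Real.lt_sqrt_of_sq_lt ?_
    calc (n : ℝ) ^ 2 < n ^ 2 + ∑ i, ∑ j, (U₀ i j) ^ 2 := lt_add_of_pos_right _ hpos
      _ = ∑ i, ∑ j, (1 + (U₀ i j) ^ 2) := by simp [Finset.sum_add_distrib, sq]
      _ ≤ _ := Finset.sum_le_sum fun i _ => Finset.sum_le_sum fun j _ => hentry i j

/-- `U₀ ↦ max_{U ∈ 𝒰} ‖U − U₀‖_F` attains its minimum over `𝒰` uniquely at `U₀ = 0`, with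
minimum value `max_{U ∈ 𝒰} ‖U‖_F = n`. -/
theorem optimal_prox_center
    (n : ℕ)
    (𝒰 : Set (Matrix (Fin n) (Fin n) ℝ))
    (h𝒰 : 𝒰 = {U | U.IsSymm ∧ ∀ i j, |U i j| ≤ 1})
    (m : Matrix (Fin n) (Fin n) ℝ → ℝ)
    (hm : ∀ U₀, m U₀ =
      sSup ((fun U => Real.sqrt (∑ i, ∑ j, (U i j - U₀ i j) ^ 2)) '' 𝒰)) :
    (0 : Matrix (Fin n) (Fin n) ℝ) ∈ 𝒰 ∧
      (∀ U₀ ∈ 𝒰, m 0 ≤ m U₀) ∧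
      (∀ U₀ ∈ 𝒰, U₀ ≠ 0 → m 0 < m U₀) ∧
      m 0 = n ∧
      IsGreatest ((fun U => Real.sqrt (∑ i, ∑ j, (U i j) ^ 2)) '' 𝒰) (n : ℝ) := by
  subst h𝒰
  have hmax := isGreatest_frobenius_image_symm_unit_box n
  have hm0 : m 0 = n := by
    rw [hm]
    simpa only [Matrix.zero_apply, sub_zero] using hmax.csSup_eq
  have hlt : ∀ U₀ ∈ {U : Matrix (Fin n) (Fin n) ℝ | U.IsSymm ∧ ∀ i j, |U i j| ≤ 1},
      U₀ ≠ 0 → m 0 < m U₀ := by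
    rintro U₀ ⟨hs, hU₀⟩ h0
    obtain ⟨U, hU, hlt⟩ := exists_lt_frobenius_dist_of_ne_zero hs h0
    rw [hm0, hm]
    exact hlt.trans_le (le_csSup (bddAbove_frobenius_dist_symm_unit_box hU₀) ⟨U, hU, rfl⟩)
  refine ⟨⟨Matrix.isSymm_zero, by simp⟩, fun U₀ hU₀ => ?_, hlt, hm0, hmax⟩
  rcases eq_or_ne U₀ 0 with rfl | h0
  · exact le_rfl
  · exact (hlt U₀ hU₀ h0).le
end

section
/- Let β > 0 and suppose X* is a positive definite matrix with X* ⪯ βI that maximizes F over the set {X : X symmetric positive definite, X ⪯ βI}. Then X* ⪰ β·e^{−β·(Tr(Σ) + nρ)}·I; that is, every eigenvalue of X* is at least β·exp(−β·(Tr(Σ) + nρ)). -/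
open Matrix

open scoped MatrixOrder Matrix.Norms.L2Operator in
theorem Matrix.PosSemidef.trace_mul_nonneg_s19 {ι : Type*} [Fintype ι] {A B : Matrix ι ι ℝ}
    (hA : A.PosSemidef) (hB : B.PosSemidef) : 0 ≤ (A * B).trace := by
  classical
  obtain ⟨C, rfl⟩ := CStarAlgebra.nonneg_iff_eq_star_mul_self.mp hB.nonneg
  rw [← Matrix.mul_assoc, Matrix.trace_mul_comm, ← Matrix.mul_assoc]
  exact (hA.mul_mul_conjTranspose_same C).trace_nonneg

open scoped MatrixOrder in
theorem Matrix.IsHermitian.posSemidef_smul_one_sub_iff {ι : Type*} [Fintype ι] [DecidableEq ι]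
    {A : Matrix ι ι ℝ} (hA : A.IsHermitian) (c : ℝ) :
    (c • (1 : Matrix ι ι ℝ) - A).PosSemidef ↔ ∀ i, hA.eigenvalues i ≤ c := by
  rw [← Matrix.le_iff, ← Algebra.algebraMap_eq_smul_one,
    le_algebraMap_iff_spectrum_le hA.isSelfAdjoint, hA.spectrum_real_eq_range_eigenvalues,
    Set.forall_mem_range]

open scoped MatrixOrder in
theorem Matrix.IsHermitian.posSemidef_sub_smul_one_iff {ι : Type*} [Fintype ι] [DecidableEq ι]
    {A : Matrix ι ι ℝ} (hA : A.IsHermitian) (c : ℝ) :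
    (A - c • (1 : Matrix ι ι ℝ)).PosSemidef ↔ ∀ i, c ≤ hA.eigenvalues i := by
  rw [← Matrix.le_iff, ← Algebra.algebraMap_eq_smul_one,
    algebraMap_le_iff_le_spectrum hA.isSelfAdjoint, hA.spectrum_real_eq_range_eigenvalues,
    Set.forall_mem_range]

/-- If all eigenvalues of a positive definite matrix are at most `β`, its log-determinant is
controlled by any single eigenvalue. -/
theorem Matrix.PosDef.log_det_le {ι : Type*} [Fintype ι] [DecidableEq ι] {A : Matrix ι ι ℝ}
    (hA : A.PosDef) {β : ℝ} (hβ : ∀ i, hA.isHermitian.eigenvalues i ≤ β) (i : ι) :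
    Real.log A.det ≤
      Real.log (hA.isHermitian.eigenvalues i) + (Fintype.card ι - 1) * Real.log β := by
  have hdet : Real.log A.det = ∑ j, Real.log (hA.isHermitian.eigenvalues j) := by
    rw [hA.isHermitian.det_eq_prod_eigenvalues]
    exact Real.log_prod fun j _ => (hA.eigenvalues_pos j).ne'
  have hle := Finset.single_le_sum
    (f := fun j => Real.log β - Real.log (hA.isHermitian.eigenvalues j))
    (fun j _ => sub_nonneg.mpr (Real.log_le_log (hA.eigenvalues_pos j) (hβ j)))
    (Finset.mem_univ i)
  simp only [Finset.sum_sub_distrib, Finset.sum_const, Finset.card_univ, nsmul_eq_mul] at hle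
  linarith

/-- Lower bound `X* ⪰ β e^{−β(Tr Σ + nρ)} I` for the optimal solution of the
`l₁`-penalized maximum likelihood problem over `{X ≻ 0 : X ⪯ βI}`. -/
theorem lower_bound_with_upper_constraint
    (n : ℕ) (hn : 0 < n)
    (Sig : Matrix (Fin n) (Fin n) ℝ) (hSig : Sig.PosSemidef) (ρ : ℝ) (hρ : 0 < ρ)
    (β : ℝ) (hβ : 0 < β)
    (Xstar : Matrix (Fin n) (Fin n) ℝ) (hXstar : Xstar.PosDef)
    (hXstarβ : (β • (1 : Matrix (Fin n) (Fin n) ℝ) - Xstar).PosSemidef)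
    (hopt : ∀ Y : Matrix (Fin n) (Fin n) ℝ, Y.PosDef →
      (β • (1 : Matrix (Fin n) (Fin n) ℝ) - Y).PosSemidef →
      Real.log Y.det - (Sig * Yᵀ).trace - ρ * ∑ i, ∑ j, |Y i j| ≤
        Real.log Xstar.det - (Sig * Xstarᵀ).trace - ρ * ∑ i, ∑ j, |Xstar i j|) :
    (Xstar - (β * Real.exp (-(β * (Sig.trace + n * ρ)))) •
        (1 : Matrix (Fin n) (Fin n) ℝ)).PosSemidef := by
  have hub := (hXstar.isHermitian.posSemidef_smul_one_sub_iff β).mp hXstarβ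
  rw [hXstar.isHermitian.posSemidef_sub_smul_one_iff]
  intro i
  have hcmp := hopt (β • 1) (Matrix.PosDef.one.smul hβ) (by simpa using Matrix.PosSemidef.zero)
  have hdet : Real.log (β • (1 : Matrix (Fin n) (Fin n) ℝ)).det = n * Real.log β := by
    simp
  have htr : (Sig * (β • (1 : Matrix (Fin n) (Fin n) ℝ))ᵀ).trace = β * Sig.trace := by
    simp
  have habs : ∑ i, ∑ j, |(β • (1 : Matrix (Fin n) (Fin n) ℝ)) i j| = n * β := by
    simp [Matrix.one_apply, apply_ite abs, abs_of_pos hβ]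
  have htrX : 0 ≤ (Sig * Xstarᵀ).trace := hSig.trace_mul_nonneg_s19 hXstar.posSemidef.transpose
  have habsX : 0 ≤ ρ * ∑ i, ∑ j, |Xstar i j| := by positivity
  have hlog := hXstar.log_det_le hub i
  rw [Fintype.card_fin] at hlog
  rw [hdet, htr, habs] at hcmp
  have hpos := hXstar.eigenvalues_pos i
  rw [← Real.log_le_log_iff (by positivity) hpos, Real.log_mul hβ.ne' (Real.exp_ne_zero _),
    Real.log_exp]
  linarith
end
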